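/- Let d = 2, let ψ_1,…,ψ_6 be any six unit vectors in ℂ² (repetitions allowed), let M be a complete qubit MUB ensemble (the union of three mutually unbiased orthonormal bases of ℂ²), and let H be a standard isotropic Gaussian Hamiltonian on ℂ². Then E_H max_{1≤i≤6} Tr(H Q_{ψ_i}) ≤ E_H max_{ψ∈M} Tr(H Q_ψ), and equivalently E_H min_{ψ∈M} Tr(H Q_ψ) ≤ E_H min_{1≤i≤6} Tr(H Q_{ψ_i}): the complete qubit MUB ensemble is globally optimal among arbitrary six-state ensembles. -/

import Mathlib

open MeasureTheory ProbabilityTheory Matrix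

noncomputable section

/-- The centered projection `Q_ψ = |ψ⟩⟨ψ| − I/d` associated to a vector `ψ ∈ ℂ^d`. -/
def Qmat {d : ℕ} (ψ : Fin d → ℂ) : Matrix (Fin d) (Fin d) ℂ :=
  Matrix.vecMulVec ψ (star ψ) - (d : ℂ)⁻¹ • (1 : Matrix (Fin d) (Fin d) ℂ)

/-- `B` is an orthonormal basis of `ℂ^d` (as a `d`-tuple of vectors). -/
def IsONB {d : ℕ} (B : Fin d → Fin d → ℂ) : Prop :=
  ∀ i j, star (B i) ⬝ᵥ B j = if i = j then (1 : ℂ) else 0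

/-- `B` is a complete system of `d+1` mutually unbiased bases of `ℂ^d`. -/
def IsCompleteMUB {d : ℕ} (B : Fin (d + 1) → Fin d → Fin d → ℂ) : Prop :=
  (∀ a, IsONB (B a)) ∧
    ∀ a b i j, a ≠ b → Complex.normSq (star (B a i) ⬝ᵥ B b j) = 1 / d

/-- `H` is a standard isotropic Gaussian Hamiltonian on `ℂ^d` under the probability
measure `μ`: it is `∑ k, g k • E k` for an orthonormal basis `E` of the real space of
traceless Hermitian `d×d` matrices (Hilbert–Schmidt inner product) and i.i.d. standard
real Gaussians `g k`. -/
def IsStdGaussianHamiltonian {d : ℕ} {Ω : Type*} [MeasurableSpace Ω]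
    (μ : Measure Ω) (H : Ω → Matrix (Fin d) (Fin d) ℂ) : Prop :=
  ∃ (E : Fin (d ^ 2 - 1) → Matrix (Fin d) (Fin d) ℂ)
    (g : Fin (d ^ 2 - 1) → Ω → ℝ),
      (∀ k, (E k).IsHermitian) ∧
      (∀ k, (E k).trace = 0) ∧
      (∀ k l, (E k * E l).trace = if k = l then (1 : ℂ) else 0) ∧
      Measurable (fun ω k => g k ω) ∧
      Measure.map (fun ω k => g k ω) μ =
        Measure.pi (fun _ : Fin (d ^ 2 - 1) => gaussianReal 0 1) ∧
      ∀ ω, H ω = ∑ k, (g k ω : ℂ) • E k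

/-- The cosine of the angle whose cotangent is `κ`. -/
def cosOfCot (κ : ℝ) : ℝ := Real.sin (Real.arctan κ)

lemma cosOfCot_eq (κ : ℝ) : cosOfCot κ = κ / √(1 + κ ^ 2) := Real.sin_arctan κ

lemma cosOfCot_le_iff {κ η : ℝ} (h1 : -(Real.pi / 2) < η) (h2 : η < Real.pi / 2) :
    cosOfCot κ ≤ Real.sin η ↔ κ ≤ Real.tan η := by
  have h3 := Real.neg_pi_div_two_lt_arctan κ
  have h4 := Real.arctan_lt_pi_div_two κ
  rw [cosOfCot, Real.strictMonoOn_sin.le_iff_le ⟨h3.le, h4.le⟩ ⟨h1.le, h2.le⟩]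
  conv_lhs => rw [← Real.arctan_tan h1 h2]
  exact Real.arctan_strictMono.le_iff_le

lemma continuous_cosOfCot : Continuous cosOfCot :=
  Real.continuous_sin.comp Real.continuous_arctan

/-- Primitive, in the angle `β`, of the moment integrand of a right-angled spherical triangle. -/
def arcPrimitive (p q a β : ℝ) : ℝ :=
  Real.sin a * Real.arctan (Real.sin a * Real.tan β)
    + (p + q) * Real.arcsin (Real.cos a * Real.sin β) - (1 + p * q) * β

/-- Angle at the vertex of the right triangle with adjacent leg `a` and hypotenuse `π/2 - η`. -/
def vertexAngle (η a : ℝ) : ℝ := Real.arccos (Real.tan η * Real.tan a)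

lemma sq_width (a β : ℝ) :
    1 - (Real.cos a * Real.sin β) ^ 2
      = Real.sin a ^ 2 * Real.sin β ^ 2 + Real.cos β ^ 2 := by
  have h1 := Real.sin_sq_add_cos_sq a
  have h2 := Real.sin_sq_add_cos_sq β
  linear_combination (Real.sin β ^ 2) * (-h1) - h2 

lemma cosOfCot_cot {a : ℝ} (h0 : 0 < Real.sin a) (β : ℝ) :
    cosOfCot (Real.cos a / Real.sin a * Real.cos β)
      = Real.cos a * Real.cos β / √(1 - (Real.cos a * Real.sin β) ^ 2) := by
  have h1 := Real.sin_sq_add_cos_sq a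
  have h2 := Real.sin_sq_add_cos_sq β
  have : 1 - (Real.cos a * Real.sin β) ^ 2
      = Real.sin a ^ 2 * (1 + (Real.cos a / Real.sin a * Real.cos β) ^ 2) := by
    field_simp
    linear_combination -h1 - (Real.cos a ^ 2) * h2
  rw [cosOfCot_eq, this, Real.sqrt_mul (sq_nonneg _), Real.sqrt_sq h0.le]
  have : √(1 + (Real.cos a / Real.sin a * Real.cos β) ^ 2) ≠ 0 := by positivity
  field_simp

lemma hasDerivAt_arcPrimitive (p q : ℝ) {a β : ℝ} (h0 : 0 < Real.sin a) (hβ : 0 < Real.cos β) :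
    HasDerivAt (arcPrimitive p q a)
      ((cosOfCot (Real.cos a / Real.sin a * Real.cos β) - p) *
        (q - cosOfCot (Real.cos a / Real.sin a * Real.cos β))) β := by
  have h1 := Real.sin_sq_add_cos_sq a
  have h2 := Real.sin_sq_add_cos_sq β
  have hw : 0 < 1 - (Real.cos a * Real.sin β) ^ 2 := by rw [sq_width]; positivity
  have hw' := Real.sq_sqrt hw.le
  have hs : 0 < √(1 - (Real.cos a * Real.sin β) ^ 2) := Real.sqrt_pos.2 hw
  have e1 : Real.cos a * Real.sin β ≠ -1 := by intro h; rw [h] at hw; norm_num at hw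
  have e2 : Real.cos a * Real.sin β ≠ 1 := by intro h; rw [h] at hw; norm_num at hw
  have d1 := (((Real.hasDerivAt_tan hβ.ne').const_mul (Real.sin a)).arctan).const_mul (Real.sin a)
  have d2 := ((Real.hasDerivAt_arcsin e1 e2).comp β
    ((Real.hasDerivAt_sin β).const_mul (Real.cos a))).const_mul (p + q)
  have d3 := (hasDerivAt_id β).const_mul (1 + p * q)
  refine ((d1.add d2).sub d3).congr_deriv ?_
  rw [cosOfCot_cot h0]
  set w := √(1 - (Real.cos a * Real.sin β) ^ 2) with hwdef
  have key : Real.sin a * (1 / (1 + (Real.sin a * Real.tan β) ^ 2) *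
      (Real.sin a * (1 / Real.cos β ^ 2))) = Real.sin a ^ 2 / w ^ 2 := by
    rw [hw', sq_width, Real.tan_eq_sin_div_cos]
    field_simp
    ring
  rw [key]
  have : Real.sin a ^ 2 = w ^ 2 - (Real.cos a * Real.cos β) ^ 2 := by
    rw [hw']; linear_combination h1 + (Real.cos a ^ 2) * h2
  rw [this]
  field_simp
  ring

section RightTriangle

variable {η a : ℝ}

lemma vertexAngle_cos_pos (hη : 0 < Real.tan η) (ha : 0 < Real.tan a) :
    0 < Real.cos (vertexAngle η a) := by
  rw [vertexAngle]
  apply Real.cos_pos_of_mem_Ioo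
  refine ⟨by linarith [Real.arccos_nonneg (Real.tan η * Real.tan a), Real.pi_pos], ?_⟩
  exact Real.arccos_lt_pi_div_two.2 (by positivity)

lemma tan_pos_of (h : 0 < a) (h' : a < Real.pi / 2) : 0 < Real.tan a :=
  Real.tan_pos_of_pos_of_lt_pi_div_two h h'

/-- The opposite leg `ℓ` of the right triangle. -/
def oppositeLeg (η a : ℝ) : ℝ := Real.arctan (Real.sin a * Real.tan (vertexAngle η a))

lemma width_vertexAngle (hη0 : 0 < η) (hη1 : η < Real.pi / 2) (ha0 : 0 < a)
    (ha1 : a < Real.pi / 2) (hlt : Real.tan η * Real.tan a ≤ 1) :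
    √(1 - (Real.cos a * Real.sin (vertexAngle η a)) ^ 2) = Real.sin a / Real.cos η ∧
    Real.cos a * Real.cos (vertexAngle η a) = Real.tan η * Real.sin a := by
  have hS : 0 < Real.sin a := Real.sin_pos_of_pos_of_lt_pi ha0 (by linarith)
  have hC : 0 < Real.cos a := Real.cos_pos_of_mem_Ioo ⟨by linarith, ha1⟩
  have hE : 0 < Real.cos η := Real.cos_pos_of_mem_Ioo ⟨by linarith, hη1⟩
  have t1 := tan_pos_of hη0 hη1
  have t2 := tan_pos_of ha0 ha1
  have hc : Real.cos (vertexAngle η a) = Real.tan η * Real.tan a :=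
    Real.cos_arccos (by nlinarith [mul_pos t1 t2]) hlt
  have hc2 : Real.cos a * Real.cos (vertexAngle η a) = Real.tan η * Real.sin a := by
    rw [hc, Real.tan_eq_sin_div_cos a]; field_simp
  refine ⟨?_, hc2⟩
  rw [Real.sqrt_eq_iff_mul_self_eq_of_pos (by positivity)]
  have h1 := Real.sin_sq_add_cos_sq a
  have h2 := Real.sin_sq_add_cos_sq (vertexAngle η a)
  have h3 := Real.sin_sq_add_cos_sq η
  have : 1 - (Real.cos a * Real.sin (vertexAngle η a)) ^ 2
      = Real.sin a ^ 2 + (Real.cos a * Real.cos (vertexAngle η a)) ^ 2 := by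
    linear_combination -h1 - Real.cos a ^ 2 * h2
  rw [this, hc2, Real.tan_eq_sin_div_cos]
  field_simp
  linear_combination -h3

lemma cos_mul_cos_oppositeLeg (hη0 : 0 < η) (hη1 : η < Real.pi / 2) (ha0 : 0 < a)
    (ha1 : a < Real.pi / 2) (hlt : Real.tan η * Real.tan a ≤ 1) :
    Real.cos a * Real.cos (oppositeLeg η a) = Real.sin η ∧
    Real.sin (oppositeLeg η a) = Real.sin (vertexAngle η a) * Real.cos η := by
  have hS : 0 < Real.sin a := Real.sin_pos_of_pos_of_lt_pi ha0 (by linarith)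
  have hE : 0 < Real.cos η := Real.cos_pos_of_mem_Ioo ⟨by linarith, hη1⟩
  obtain ⟨hw, hc⟩ := width_vertexAngle hη0 hη1 ha0 ha1 hlt
  have hcp := vertexAngle_cos_pos (tan_pos_of hη0 hη1) (tan_pos_of ha0 ha1)
  rw [sq_width] at hw
  set b := vertexAngle η a
  have e : √(1 + (Real.sin a * Real.tan b) ^ 2) = Real.sin a / Real.cos η / Real.cos b := by
    rw [← hw, Real.tan_eq_sin_div_cos]
    have : 1 + (Real.sin a * (Real.sin b / Real.cos b)) ^ 2
      = (Real.sin a ^ 2 * Real.sin b ^ 2 + Real.cos b ^ 2) / Real.cos b ^ 2 := by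
      field_simp; ring
    rw [this, Real.sqrt_div (by positivity), Real.sqrt_sq hcp.le]
  rw [oppositeLeg, Real.cos_arctan, Real.sin_arctan, e]
  constructor
  · have : Real.cos a * (1 / (Real.sin a / Real.cos η / Real.cos b))
      = (Real.cos a * Real.cos b) * (Real.cos η / Real.sin a) := by field_simp
    rw [this, hc, Real.tan_eq_sin_div_cos]; field_simp
  · change Real.sin a * Real.tan b / _ = Real.sin b * Real.cos η
    rw [Real.tan_eq_sin_div_cos]; field_simp

lemma hasDerivAt_arcPrimitive_vertexAngle {p q : ℝ} (hη0 : 0 < η) (hη1 : η < Real.pi / 2)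
    (ha0 : 0 < a) (ha1 : a < Real.pi / 2) (hlt : Real.tan η * Real.tan a < 1)
    (hpq : (Real.sin η - p) * (q - Real.sin η) = 0) :
    HasDerivAt (fun a => arcPrimitive p q a (vertexAngle η a))
      (Real.cos a * oppositeLeg η a +
        (Real.sin η - p - q) * Real.sin (oppositeLeg η a)) a := by
  have hS : 0 < Real.sin a := Real.sin_pos_of_pos_of_lt_pi ha0 (by linarith)
  have hC : 0 < Real.cos a := Real.cos_pos_of_mem_Ioo ⟨by linarith, ha1⟩
  have hE : 0 < Real.cos η := Real.cos_pos_of_mem_Ioo ⟨by linarith, hη1⟩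
  have t1 := tan_pos_of hη0 hη1
  have t2 := tan_pos_of ha0 ha1
  obtain ⟨hw, hc⟩ := width_vertexAngle hη0 hη1 ha0 ha1 hlt.le
  obtain ⟨hl1, hl2⟩ := cos_mul_cos_oppositeLeg hη0 hη1 ha0 ha1 hlt.le
  have hcp := vertexAngle_cos_pos t1 t2
  obtain ⟨b', hb⟩ : ∃ b', HasDerivAt (vertexAngle η) b' a :=
    ⟨_, (Real.hasDerivAt_arccos (by nlinarith [mul_pos t1 t2]) hlt.ne).comp a
      ((Real.hasDerivAt_tan hC.ne').const_mul (Real.tan η))⟩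
  set b := vertexAngle η a with hbdef
  have hw0 : 0 < 1 - (Real.cos a * Real.sin b) ^ 2 := by rw [sq_width]; positivity
  have e1 : Real.cos a * Real.sin b ≠ -1 := by intro h; rw [h] at hw0; norm_num at hw0
  have e2 : Real.cos a * Real.sin b ≠ 1 := by intro h; rw [h] at hw0; norm_num at hw0
  have dt : HasDerivAt (fun a => Real.tan (vertexAngle η a)) (1 / Real.cos b ^ 2 * b') a :=
    HasDerivAt.comp (h₂ := Real.tan) a (Real.hasDerivAt_tan hcp.ne') hb
  have ds : HasDerivAt (fun a => Real.sin (vertexAngle η a)) (Real.cos b * b') a :=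
    HasDerivAt.comp (h₂ := Real.sin) a (Real.hasDerivAt_sin _) hb
  have d1 := (Real.hasDerivAt_sin a).mul ((Real.hasDerivAt_sin a).mul dt).arctan
  have d2 := ((Real.hasDerivAt_arcsin e1 e2).comp a
    ((Real.hasDerivAt_cos a).mul ds)).const_mul (p + q)
  have d3 := hb.const_mul (1 + p * q)
  refine ((d1.add d2).sub d3).congr_deriv ?_
  simp only [Pi.mul_apply, ← hbdef]
  rw [hw]
  have hw2 : Real.sin a ^ 2 * Real.sin b ^ 2 + Real.cos b ^ 2 = (Real.sin a / Real.cos η) ^ 2 := by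
    rw [← sq_width, ← hw, Real.sq_sqrt hw0.le]
  have k1 : 1 / (1 + (Real.sin a * Real.tan b) ^ 2)
      = Real.cos b ^ 2 * Real.cos η ^ 2 / Real.sin a ^ 2 := by
    have : 1 + (Real.sin a * Real.tan b) ^ 2 = (Real.sin a / Real.cos η) ^ 2 / Real.cos b ^ 2 := by
      rw [← hw2, Real.tan_eq_sin_div_cos]; field_simp; ring
    rw [this]; field_simp
  have hll : Real.arctan (Real.sin a * Real.tan b) = oppositeLeg η a := rfl
  rw [k1, hl2, hll, Real.tan_eq_sin_div_cos b]
  have h3 := Real.sin_sq_add_cos_sq η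
  have hc' : Real.cos a * Real.cos b * Real.cos η = Real.sin η * Real.sin a := by
    rw [hc, Real.tan_eq_sin_div_cos]; field_simp
  field_simp
  linear_combination (b' * (p + q) + Real.sin b * Real.cos η) * hc' +
    b' * Real.sin a * h3 + b' * Real.sin a * hpq

end RightTriangle

/-- The angle between a face normal and an edge midpoint of the regular octahedron. -/
def lowAngle : ℝ := Real.arctan (1 / √2)

/-- Cosine of the circumradius of a face of the regular octahedron. -/
def lowLevel : ℝ := Real.sin lowAngle

/-- The second level at which the weight `cellWeight` vanishes, chosen so that edges of the
regular octahedron are critical. -/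
def highLevel : ℝ := lowAngle / Real.cos lowAngle

/-- The angle whose sine is `highLevel`. -/
def highAngle : ℝ := Real.arcsin highLevel

lemma tan_lowAngle : Real.tan lowAngle = 1 / √2 := Real.tan_arctan _

lemma lowAngle_pos : 0 < lowAngle := Real.arctan_pos.2 (by positivity)

lemma lowAngle_lt : lowAngle < Real.pi / 4 := by
  rw [lowAngle, ← Real.arctan_one]
  apply Real.arctan_strictMono
  rw [div_lt_one (by positivity)]
  exact Real.lt_sqrt_of_sq_lt (by norm_num)

lemma sqrt_one_add_tan_lowAngle : √(1 + (1 / √2) ^ 2) = √3 / √2 := by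
  rw [← Real.sqrt_div (by norm_num), div_pow, Real.sq_sqrt (by norm_num)]
  norm_num

lemma cos_lowAngle : Real.cos lowAngle = √2 / √3 := by
  rw [lowAngle, Real.cos_arctan, sqrt_one_add_tan_lowAngle, one_div_div]

lemma lowLevel_eq : lowLevel = 1 / √3 := by
  rw [lowLevel, lowAngle, Real.sin_arctan, sqrt_one_add_tan_lowAngle]
  field_simp

lemma lowLevel_pos : 0 < lowLevel := by rw [lowLevel_eq]; positivity

lemma cos_lowAngle_pos : 0 < Real.cos lowAngle := by rw [cos_lowAngle]; positivity

lemma inv_sqrt_two_lt_highLevel : 1 / √2 < highLevel := by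
  rw [← tan_lowAngle, Real.tan_eq_sin_div_cos, highLevel]
  exact div_lt_div_of_pos_right (Real.sin_lt lowAngle_pos) cos_lowAngle_pos

lemma lowLevel_lt_highLevel : lowLevel < highLevel := by
  refine lt_trans ?_ inv_sqrt_two_lt_highLevel
  rw [lowLevel_eq]
  exact one_div_lt_one_div_of_lt (by positivity) (Real.sqrt_lt_sqrt (by norm_num) (by norm_num))

lemma highLevel_pos : 0 < highLevel := lowLevel_pos.trans lowLevel_lt_highLevel

lemma highLevel_lt_one : highLevel < 1 := by
  have h : lowAngle < 1 / √2 := by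
    rw [← tan_lowAngle]
    exact Real.lt_tan lowAngle_pos (by linarith [lowAngle_lt, Real.pi_pos])
  rw [highLevel, div_lt_one cos_lowAngle_pos, cos_lowAngle]
  refine h.trans ?_
  rw [div_lt_div_iff₀ (by positivity) (by positivity)]
  have h3 : √3 < 2 := by rw [Real.sqrt_lt' (by norm_num)]; norm_num
  nlinarith [Real.mul_self_sqrt (show (0:ℝ) ≤ 2 by norm_num)]

lemma sin_highAngle : Real.sin highAngle = highLevel :=
  Real.sin_arcsin (by linarith [highLevel_pos]) highLevel_lt_one.le

lemma highAngle_lt : highAngle < Real.pi / 2 := Real.arcsin_lt_pi_div_two.2 highLevel_lt_one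

lemma lt_highAngle : Real.pi / 4 < highAngle := by
  rw [highAngle, Real.lt_arcsin_iff_sin_lt' ⟨by linarith [Real.pi_pos], by linarith [Real.pi_pos]⟩,
    Real.sin_pi_div_four]
  refine lt_of_eq_of_lt ?_ inv_sqrt_two_lt_highLevel
  rw [div_eq_div_iff (by norm_num) (by positivity)]; simp

lemma highAngle_pos : 0 < highAngle := by linarith [lt_highAngle, Real.pi_pos]

/-- Closed form of half of the contribution of an edge with half-length `a`. -/
def edgeGain (a : ℝ) : ℝ :=
  arcPrimitive lowLevel highLevel a (vertexAngle lowAngle a) -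
    arcPrimitive lowLevel highLevel a (vertexAngle highAngle a)

lemma tan_mul_tan_lt_one {η a : ℝ} (hη0 : 0 < η) (ha0 : 0 < a) (h : η + a < Real.pi / 2) :
    Real.tan η * Real.tan a < 1 := by
  have h1 : Real.tan a < Real.tan (Real.pi / 2 - η) :=
    Real.tan_lt_tan_of_nonneg_of_lt_pi_div_two ha0.le (by linarith) (by linarith)
  rw [Real.tan_pi_div_two_sub] at h1
  have := tan_pos_of hη0 (by linarith)
  rwa [lt_inv_comm₀ (tan_pos_of ha0 (by linarith)) this, ← one_div,
    lt_div_iff₀ (tan_pos_of ha0 (by linarith))] at h1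

lemma vertexAngle_eq_zero {η a : ℝ} (hη1 : η < Real.pi / 2) (hη0 : 0 < η)
    (ha1 : a < Real.pi / 2) (h : Real.pi / 2 ≤ η + a) : vertexAngle η a = 0 := by
  rw [vertexAngle, Real.arccos_eq_zero]
  have h1 : Real.tan (Real.pi / 2 - η) ≤ Real.tan a := by
    rcases h.eq_or_lt with h | h
    · rw [h, add_sub_cancel_left]
    · exact (Real.tan_lt_tan_of_nonneg_of_lt_pi_div_two (by linarith) ha1 (by linarith)).le
  rw [Real.tan_pi_div_two_sub] at h1
  have := tan_pos_of hη0 hη1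
  rwa [inv_le_iff_one_le_mul₀' this] at h1

lemma arcPrimitive_zero (p q a : ℝ) : arcPrimitive p q a 0 = 0 := by simp [arcPrimitive]

lemma continuousOn_arcPrimitive_vertexAngle (p q : ℝ) {η : ℝ} (hη0 : 0 < η)
    (hη1 : η < Real.pi / 2) :
    ContinuousOn (fun a => arcPrimitive p q a (vertexAngle η a)) (Set.Ioo 0 (Real.pi / 2)) := by
  intro a ha
  apply ContinuousAt.continuousWithinAt
  have hC : Real.cos a ≠ 0 := (Real.cos_pos_of_mem_Ioo ⟨by linarith [ha.1, Real.pi_pos], ha.2⟩).ne'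
  have hb : ContinuousAt (vertexAngle η) a :=
    Real.continuous_arccos.continuousAt.comp
      (continuousAt_const.mul (Real.continuousAt_tan.2 hC))
  have hc := (vertexAngle_cos_pos (tan_pos_of hη0 hη1) (tan_pos_of ha.1 ha.2)).ne'
  have ht : ContinuousAt (fun a => Real.tan (vertexAngle η a)) a :=
    ContinuousAt.comp (g := Real.tan) (Real.continuousAt_tan.2 hc) hb
  unfold arcPrimitive
  have hs := Real.continuous_sin.continuousAt (x := a)
  exact ((hs.mul (Real.continuous_arctan.continuousAt.comp (hs.mul ht))).add
    (continuousAt_const.mul (Real.continuous_arcsin.continuousAt.comp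
      (Real.continuous_cos.continuousAt.mul (Real.continuous_sin.continuousAt.comp hb))))).sub
      (continuousAt_const.mul hb)

lemma continuousOn_edgeGain : ContinuousOn edgeGain (Set.Ioo 0 (Real.pi / 2)) :=
  (continuousOn_arcPrimitive_vertexAngle _ _ lowAngle_pos
    (by linarith [lowAngle_lt, Real.pi_pos])).sub
    (continuousOn_arcPrimitive_vertexAngle _ _ highAngle_pos highAngle_lt)

lemma hasDerivAt_edgeGain_low {a : ℝ} (ha0 : 0 < a) (h1 : lowAngle + a < Real.pi / 2) :
    HasDerivAt (fun a => arcPrimitive lowLevel highLevel a (vertexAngle lowAngle a))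
      (Real.cos a * oppositeLeg lowAngle a - highLevel * Real.sin (oppositeLeg lowAngle a)) a := by
  have hl := lowAngle_lt
  have := Real.pi_pos
  refine (hasDerivAt_arcPrimitive_vertexAngle (p := lowLevel) (q := highLevel) lowAngle_pos
    (by linarith) ha0 (by linarith [lowAngle_pos]) (tan_mul_tan_lt_one lowAngle_pos ha0 h1)
    (by simp [lowLevel])).congr_deriv ?_
  rw [← lowLevel]; ring

lemma hasDerivAt_edgeGain_high {a : ℝ} (ha0 : 0 < a) (h1 : highAngle + a < Real.pi / 2) :
    HasDerivAt (fun a => arcPrimitive lowLevel highLevel a (vertexAngle highAngle a))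
      (Real.cos a * oppositeLeg highAngle a - lowLevel * Real.sin (oppositeLeg highAngle a)) a := by
  refine (hasDerivAt_arcPrimitive_vertexAngle (p := lowLevel) (q := highLevel) highAngle_pos
    highAngle_lt ha0 (by linarith [highAngle_pos]) (tan_mul_tan_lt_one highAngle_pos ha0 h1)
    (by simp [sin_highAngle])).congr_deriv ?_
  rw [sin_highAngle]; ring

lemma hasDerivAt_edgeGain_far {a : ℝ} (ha1 : lowAngle + a < Real.pi / 2)
    (h1 : Real.pi / 2 < highAngle + a) :
    HasDerivAt edgeGain
      (Real.cos a * oppositeLeg lowAngle a - highLevel * Real.sin (oppositeLeg lowAngle a)) a := by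
  have h0 : 0 < a := by linarith [highAngle_lt]
  refine (hasDerivAt_edgeGain_low h0 ha1).congr_of_eventuallyEq ?_
  filter_upwards [Ioo_mem_nhds (show Real.pi / 2 - highAngle < a by linarith)
    (show a < Real.pi / 2 by linarith [lowAngle_pos])] with x hx
  rw [edgeGain, vertexAngle_eq_zero highAngle_lt highAngle_pos hx.2 (by linarith [hx.1]),
    arcPrimitive_zero, sub_zero]

lemma oppositeLeg_mem {η a : ℝ} (hη0 : 0 < η) (hη1 : η < Real.pi / 2) (ha0 : 0 < a)
    (ha1 : a < Real.pi / 2) : 0 ≤ oppositeLeg η a ∧ oppositeLeg η a < Real.pi / 2 := by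
  refine ⟨?_, Real.arctan_lt_pi_div_two _⟩
  apply Real.arctan_nonneg.2
  have hc := vertexAngle_cos_pos (tan_pos_of hη0 hη1) (tan_pos_of ha0 ha1)
  rw [Real.tan_eq_sin_div_cos]
  exact mul_nonneg (Real.sin_pos_of_pos_of_lt_pi ha0 (by linarith)).le
    (div_nonneg (Real.sin_nonneg_of_nonneg_of_le_pi (Real.arccos_nonneg _) (Real.arccos_le_pi _))
      hc.le)

lemma mul_sin_le_mul_sin {s t : ℝ} (hs : 0 ≤ s) (hst : s ≤ t) (ht : t ≤ Real.pi) :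
    s * Real.sin t ≤ t * Real.sin s := by
  rcases (hs.trans hst).eq_or_lt with h | h
  · have : s = 0 := by linarith
    simp [this, ← h]
  have := strictConcaveOn_sin_Icc.concaveOn.2
    (show (0 : ℝ) ∈ Set.Icc 0 Real.pi from ⟨le_rfl, Real.pi_pos.le⟩)
    (show t ∈ Set.Icc 0 Real.pi from ⟨h.le, ht⟩)
    (show 0 ≤ 1 - s / t by rw [sub_nonneg, div_le_one h]; exact hst)
    (show 0 ≤ s / t by positivity) (by ring)
  simp only [smul_eq_mul, Real.sin_zero, mul_zero, zero_add] at this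
  rw [div_mul_cancel₀ _ h.ne', div_mul_eq_mul_div, div_le_iff₀ h] at this
  linarith

lemma mul_sin_mul_cos_le {s t : ℝ} (hs : 0 ≤ s) (hst : s ≤ t) (ht : t ≤ Real.pi / 2) :
    s * (Real.sin t * Real.cos t) ≤ t * (Real.sin s * Real.cos s) := by
  have := mul_sin_le_mul_sin (s := 2 * s) (t := 2 * t) (by linarith) (by linarith) (by linarith)
  rw [Real.sin_two_mul, Real.sin_two_mul] at this
  nlinarith

lemma cos_oppositeLeg_low {a : ℝ} (ha0 : 0 < a) (h1 : lowAngle + a < Real.pi / 2) :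
    Real.cos a * Real.cos (oppositeLeg lowAngle a) = lowLevel := by
  have hl := lowAngle_lt
  have := Real.pi_pos
  exact (cos_mul_cos_oppositeLeg lowAngle_pos (by linarith) ha0 (by linarith [lowAngle_pos])
    (tan_mul_tan_lt_one lowAngle_pos ha0 h1).le).1

lemma cos_pi_div_four_mul : Real.cos (Real.pi / 4) * Real.cos lowAngle = lowLevel := by
  rw [lowLevel_eq, cos_lowAngle, Real.cos_pi_div_four]
  field_simp
  simp

lemma cos_mul_oppositeLeg_eq {a : ℝ} (ha0 : 0 < a) (h1 : lowAngle + a < Real.pi / 2) :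
    Real.cos a * oppositeLeg lowAngle a - highLevel * Real.sin (oppositeLeg lowAngle a) =
      (oppositeLeg lowAngle a * (Real.sin lowAngle * Real.cos lowAngle) -
        lowAngle * (Real.sin (oppositeLeg lowAngle a) * Real.cos (oppositeLeg lowAngle a))) /
        (Real.cos (oppositeLeg lowAngle a) * Real.cos lowAngle) := by
  have hc := cos_oppositeLeg_low ha0 h1
  have hp := lowLevel_pos
  have hca : 0 < Real.cos a :=
    Real.cos_pos_of_mem_Ioo ⟨by linarith [Real.pi_pos], by linarith [lowAngle_pos]⟩
  have hcl : 0 < Real.cos (oppositeLeg lowAngle a) := by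
    by_contra h
    nlinarith
  have := cos_lowAngle_pos
  rw [lowLevel] at hc
  rw [highLevel, ← hc]
  field_simp

lemma edgeGain_antitoneOn :
    AntitoneOn edgeGain (Set.Icc (Real.pi / 4) (Real.pi / 2 - lowAngle)) := by
  have h0 := lowAngle_pos
  have h1 := lowAngle_lt
  have h2 := lt_highAngle
  have hd : ∀ a ∈ interior (Set.Icc (Real.pi / 4) (Real.pi / 2 - lowAngle)), HasDerivAt edgeGain
      (Real.cos a * oppositeLeg lowAngle a - highLevel * Real.sin (oppositeLeg lowAngle a)) a := by
    intro a ha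
    rw [interior_Icc] at ha
    exact hasDerivAt_edgeGain_far (by linarith [ha.2]) (by linarith [ha.1])
  refine antitoneOn_of_deriv_nonpos (convex_Icc _ _) (continuousOn_edgeGain.mono ?_)
    (fun a ha => (hd a ha).differentiableAt.differentiableWithinAt) fun a ha => ?_
  · exact fun x hx => ⟨by linarith [hx.1], by linarith [hx.2]⟩
  rw [(hd a ha).deriv]
  rw [interior_Icc] at ha
  have ha0 : 0 < a := by linarith [ha.1]
  have ha1 : lowAngle + a < Real.pi / 2 := by linarith [ha.2]
  rw [cos_mul_oppositeLeg_eq ha0 ha1]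
  obtain ⟨m1, m2⟩ := oppositeLeg_mem lowAngle_pos (by linarith) ha0 (by linarith)
  have hc := cos_oppositeLeg_low ha0 ha1
  rw [← cos_pi_div_four_mul] at hc
  have hlt : Real.cos a < Real.cos (Real.pi / 4) :=
    Real.cos_lt_cos_of_nonneg_of_le_pi (by linarith) (by linarith) ha.1
  have hcl : 0 < Real.cos (oppositeLeg lowAngle a) := Real.cos_pos_of_mem_Ioo ⟨by linarith, m2⟩
  have hcos : Real.cos lowAngle < Real.cos (oppositeLeg lowAngle a) := by
    have hp : 0 < Real.cos (Real.pi / 4) := by rw [Real.cos_pi_div_four]; positivity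
    nlinarith
  have hle : oppositeLeg lowAngle a ≤ lowAngle := by
    by_contra h
    exact absurd (Real.cos_le_cos_of_nonneg_of_le_pi h0.le (by linarith) (not_le.1 h).le)
      (not_le.2 hcos)
  apply div_nonpos_of_nonpos_of_nonneg
  · linarith [mul_sin_mul_cos_le m1 hle (by linarith)]
  · exact (mul_pos hcl cos_lowAngle_pos).le

lemma edgeGain_monotoneOn :
    MonotoneOn edgeGain (Set.Icc (Real.pi / 2 - highAngle) (Real.pi / 4)) := by
  have h0 := lowAngle_pos
  have h1 := lowAngle_lt
  have h2 := lt_highAngle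
  have h3 := highAngle_lt
  have hd : ∀ a ∈ interior (Set.Icc (Real.pi / 2 - highAngle) (Real.pi / 4)), HasDerivAt edgeGain
      (Real.cos a * oppositeLeg lowAngle a - highLevel * Real.sin (oppositeLeg lowAngle a)) a := by
    intro a ha
    rw [interior_Icc] at ha
    exact hasDerivAt_edgeGain_far (by linarith [ha.2]) (by linarith [ha.1])
  refine monotoneOn_of_deriv_nonneg (convex_Icc _ _) (continuousOn_edgeGain.mono ?_)
    (fun a ha => (hd a ha).differentiableAt.differentiableWithinAt) fun a ha => ?_
  · exact fun x hx => ⟨by linarith [hx.1], by linarith [hx.2]⟩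
  rw [(hd a ha).deriv]
  rw [interior_Icc] at ha
  have ha0 : 0 < a := by linarith [ha.1]
  have ha1 : lowAngle + a < Real.pi / 2 := by linarith [ha.2]
  rw [cos_mul_oppositeLeg_eq ha0 ha1]
  obtain ⟨m1, m2⟩ := oppositeLeg_mem lowAngle_pos (by linarith) ha0 (by linarith)
  have hc := cos_oppositeLeg_low ha0 ha1
  rw [← cos_pi_div_four_mul] at hc
  have hlt : Real.cos (Real.pi / 4) < Real.cos a :=
    Real.cos_lt_cos_of_nonneg_of_le_pi (by linarith) (by linarith) ha.2
  have hcl : 0 < Real.cos (oppositeLeg lowAngle a) := Real.cos_pos_of_mem_Ioo ⟨by linarith, m2⟩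
  have hcos : Real.cos (oppositeLeg lowAngle a) < Real.cos lowAngle := by
    have hp : 0 < Real.cos (Real.pi / 4) := by rw [Real.cos_pi_div_four]; positivity
    nlinarith
  have hle : lowAngle ≤ oppositeLeg lowAngle a := by
    by_contra h
    exact absurd (Real.cos_le_cos_of_nonneg_of_le_pi m1 (by linarith) (not_le.1 h).le)
      (not_le.2 hcos)
  apply div_nonneg
  · linarith [mul_sin_mul_cos_le h0.le hle m2.le]
  · exact (mul_pos hcl cos_lowAngle_pos).le

lemma edgeGain_monotoneOn_near {c : ℝ} (hc : 0 < c) :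
    MonotoneOn edgeGain (Set.Icc c (Real.pi / 2 - highAngle)) := by
  have h0 := lowAngle_pos
  have h1 := lowAngle_lt
  have h2 := lt_highAngle
  have h3 := highAngle_lt
  have hd : ∀ a ∈ interior (Set.Icc c (Real.pi / 2 - highAngle)), HasDerivAt edgeGain
      (Real.cos a * oppositeLeg lowAngle a - highLevel * Real.sin (oppositeLeg lowAngle a) -
        (Real.cos a * oppositeLeg highAngle a - lowLevel * Real.sin (oppositeLeg highAngle a)))
      a := by
    intro a ha
    rw [interior_Icc] at ha
    exact (hasDerivAt_edgeGain_low (by linarith [ha.1]) (by linarith [ha.2])).sub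
      (hasDerivAt_edgeGain_high (by linarith [ha.1]) (by linarith [ha.2]))
  refine monotoneOn_of_deriv_nonneg (convex_Icc _ _) (continuousOn_edgeGain.mono ?_)
    (fun a ha => (hd a ha).differentiableAt.differentiableWithinAt) fun a ha => ?_
  · exact fun x hx => ⟨by linarith [hx.1], by linarith [hx.2]⟩
  rw [(hd a ha).deriv]
  rw [interior_Icc] at ha
  have ha0 : 0 < a := by linarith [ha.1]
  have ha1 : highAngle + a < Real.pi / 2 := by linarith [ha.2]
  obtain ⟨m1, m2⟩ := oppositeLeg_mem lowAngle_pos (by linarith) ha0 (by linarith)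
  obtain ⟨n1, n2⟩ := oppositeLeg_mem highAngle_pos (by linarith) ha0 (by linarith)
  have hl := cos_oppositeLeg_low ha0 (by linarith)
  have hh := (cos_mul_cos_oppositeLeg highAngle_pos (by linarith) ha0 (by linarith)
    (tan_mul_tan_lt_one highAngle_pos ha0 ha1).le).1
  rw [sin_highAngle] at hh
  have hca : 0 < Real.cos a := Real.cos_pos_of_mem_Ioo ⟨by linarith, by linarith⟩
  have hcos : Real.cos (oppositeLeg lowAngle a) < Real.cos (oppositeLeg highAngle a) := by
    have := lowLevel_lt_highLevel
    rw [← hl, ← hh] at this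
    exact lt_of_mul_lt_mul_left this hca.le
  have hle : oppositeLeg highAngle a ≤ oppositeLeg lowAngle a := by
    by_contra h
    exact absurd (Real.cos_le_cos_of_nonneg_of_le_pi m1 (by linarith) (not_le.1 h).le)
      (not_le.2 hcos)
  rw [← hl, ← hh]
  have hs := Real.sin_le (sub_nonneg.2 hle)
  rw [Real.sin_sub] at hs
  nlinarith [mul_le_mul_of_nonneg_left hs hca.le]

lemma edgeGain_le {a : ℝ} (ha0 : 0 < a) (ha1 : a < Real.pi / 2) :
    edgeGain a ≤ edgeGain (Real.pi / 4) := by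
  have h0 := lowAngle_pos
  have h1 := lowAngle_lt
  have h2 := lt_highAngle
  have h3 := highAngle_lt
  rcases le_total a (Real.pi / 2 - highAngle) with h | h
  · exact (edgeGain_monotoneOn_near ha0 ⟨le_rfl, h⟩ ⟨h, le_rfl⟩ h).trans
      (edgeGain_monotoneOn ⟨le_rfl, by linarith⟩ ⟨by linarith, le_rfl⟩ (by linarith))
  rcases le_total a (Real.pi / 4) with h' | h'
  · exact edgeGain_monotoneOn ⟨h, h'⟩ ⟨by linarith, le_rfl⟩ h'
  rcases le_total a (Real.pi / 2 - lowAngle) with h4 | h4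
  · exact edgeGain_antitoneOn ⟨le_rfl, by linarith⟩ ⟨h', h4⟩ h'
  have hz : ∀ b, b < Real.pi / 2 → Real.pi / 2 - lowAngle ≤ b → edgeGain b = 0 := by
    intro b hb hb'
    rw [edgeGain, vertexAngle_eq_zero (by linarith) h0 hb (by linarith),
      vertexAngle_eq_zero h3 (by linarith) hb (by linarith), sub_self]
  rw [hz a ha1 h4, ← hz (Real.pi / 2 - lowAngle) (by linarith) le_rfl]
  exact edgeGain_antitoneOn ⟨le_rfl, by linarith⟩ ⟨by linarith, le_rfl⟩ (by linarith)

/-- The positive part of the quadratic polynomial vanishing at `lowLevel` and `highLevel`. -/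
def cellWeight (x : ℝ) : ℝ := max 0 ((x - lowLevel) * (highLevel - x))

/-- The largest possible contribution of an edge, where `k` is the cotangent of the half-length. -/
def edgeIntegral (k : ℝ) : ℝ :=
  ∫ β in -Real.pi..Real.pi, cellWeight (cosOfCot (k * Real.cos β))

lemma continuous_cellWeight : Continuous cellWeight := by
  unfold cellWeight; fun_prop

lemma cellWeight_nonneg (x : ℝ) : 0 ≤ cellWeight x := le_max_left _ _

lemma cellWeight_of_le {x : ℝ} (h : x ≤ lowLevel) : cellWeight x = 0 :=
  max_eq_left (mul_nonpos_of_nonpos_of_nonneg (by linarith) (by linarith [lowLevel_lt_highLevel]))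

lemma cellWeight_of_ge {x : ℝ} (h : highLevel ≤ x) : cellWeight x = 0 :=
  max_eq_left (mul_nonpos_of_nonneg_of_nonpos (by linarith [lowLevel_lt_highLevel]) (by linarith))

lemma cellWeight_of_mem {x : ℝ} (h : lowLevel ≤ x) (h' : x ≤ highLevel) :
    cellWeight x = (x - lowLevel) * (highLevel - x) :=
  max_eq_right (mul_nonneg (by linarith) (by linarith))

lemma cos_le_of_arccos_le {z β : ℝ} (hz : 0 < z) (hβ : β ≤ Real.pi) (h : Real.arccos z ≤ β) :
    Real.cos β ≤ z := by
  rcases le_total 1 z with h1 | h1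
  · exact (Real.cos_le_one _).trans h1
  · rw [← Real.cos_arccos (by linarith) h1]
    exact Real.cos_le_cos_of_nonneg_of_le_pi (Real.arccos_nonneg _) hβ h

lemma le_cos_of_lt_arccos {z β : ℝ} (hz : 0 < z) (hβ : 0 ≤ β) (h : β < Real.arccos z) :
    z ≤ Real.cos β := by
  have h1 : z < 1 := Real.arccos_pos.1 (hβ.trans_lt h)
  rw [← Real.cos_arccos (by linarith) h1.le]
  exact Real.cos_le_cos_of_nonneg_of_le_pi hβ (Real.arccos_le_pi _) h.le

section VertexAngle

variable {η a β : ℝ}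

lemma cosOfCot_le_of_vertexAngle_le (hη0 : 0 < η) (hη1 : η < Real.pi / 2) (ha0 : 0 < a)
    (ha1 : a < Real.pi / 2) (hβ : β ≤ Real.pi) (h : vertexAngle η a ≤ β) :
    cosOfCot (Real.cos a / Real.sin a * Real.cos β) ≤ Real.sin η := by
  rw [cosOfCot_le_iff (by linarith) hη1]
  have hC : 0 < Real.cos a := Real.cos_pos_of_mem_Ioo ⟨by linarith, ha1⟩
  have hS : 0 < Real.sin a := Real.sin_pos_of_pos_of_lt_pi ha0 (by linarith)
  have := cos_le_of_arccos_le (mul_pos (tan_pos_of hη0 hη1) (tan_pos_of ha0 ha1)) hβ h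
  calc _ ≤ Real.cos a / Real.sin a * (Real.tan η * Real.tan a) :=
        mul_le_mul_of_nonneg_left this (by positivity)
    _ = Real.tan η := by rw [Real.tan_eq_sin_div_cos a]; field_simp

lemma le_cosOfCot_of_lt_vertexAngle (hη0 : 0 < η) (hη1 : η < Real.pi / 2) (ha0 : 0 < a)
    (ha1 : a < Real.pi / 2) (hβ : 0 ≤ β) (h : β < vertexAngle η a) :
    Real.sin η ≤ cosOfCot (Real.cos a / Real.sin a * Real.cos β) := by
  have hC : 0 < Real.cos a := Real.cos_pos_of_mem_Ioo ⟨by linarith, ha1⟩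
  have hS : 0 < Real.sin a := Real.sin_pos_of_pos_of_lt_pi ha0 (by linarith)
  have := le_cos_of_lt_arccos (mul_pos (tan_pos_of hη0 hη1) (tan_pos_of ha0 ha1)) hβ h
  have h2 : Real.tan η ≤ Real.cos a / Real.sin a * Real.cos β := by
    calc Real.tan η = Real.cos a / Real.sin a * (Real.tan η * Real.tan a) := by
          rw [Real.tan_eq_sin_div_cos a]; field_simp
      _ ≤ _ := mul_le_mul_of_nonneg_left this (by positivity)
  by_contra hlt
  rw [not_le] at hlt
  have h3 := (cosOfCot_le_iff (by linarith) hη1).1 hlt.le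
  have h4 := le_antisymm h2 h3
  rw [← h4, cosOfCot, Real.arctan_tan (by linarith) hη1] at hlt
  exact lt_irrefl _ hlt

end VertexAngle

lemma continuous_edge (k : ℝ) : Continuous fun β => cellWeight (cosOfCot (k * Real.cos β)) :=
  continuous_cellWeight.comp
    (continuous_cosOfCot.comp (continuous_const.mul Real.continuous_cos))

lemma edgeIntegral_cot {a : ℝ} (ha0 : 0 < a) (ha1 : a < Real.pi / 2) :
    edgeIntegral (Real.cos a / Real.sin a) = 2 * edgeGain a := by
  have h0 := lowAngle_pos
  have h1 := lowAngle_lt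
  have h2 := lt_highAngle
  have h3 := highAngle_lt
  have hS : 0 < Real.sin a := Real.sin_pos_of_pos_of_lt_pi ha0 (by linarith)
  set k := Real.cos a / Real.sin a with hk
  set f := fun β => cellWeight (cosOfCot (k * Real.cos β)) with hf
  have hfc : Continuous f := continuous_edge k
  have hi : ∀ x y, IntervalIntegrable f volume x y := fun x y => hfc.intervalIntegrable x y
  have heven : ∫ β in -Real.pi..0, f β = ∫ β in 0..Real.pi, f β := by
    rw [← neg_zero, ← intervalIntegral.integral_comp_neg]
    simp [hf]
  have hle : vertexAngle highAngle a ≤ vertexAngle lowAngle a := by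
    apply Real.antitone_arccos
    apply mul_le_mul_of_nonneg_right _ (tan_pos_of ha0 ha1).le
    exact (Real.tan_lt_tan_of_nonneg_of_lt_pi_div_two h0.le h3 (by linarith)).le
  have hge0 : 0 ≤ vertexAngle highAngle a := Real.arccos_nonneg _
  have hlepi : vertexAngle lowAngle a ≤ Real.pi := Real.arccos_le_pi _
  have z1 : ∫ β in 0..vertexAngle highAngle a, f β = 0 := by
    rw [intervalIntegral.integral_of_le hge0, integral_Ioc_eq_integral_Ioo]
    refine setIntegral_eq_zero_of_forall_eq_zero fun β hβ => cellWeight_of_ge ?_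
    rw [← sin_highAngle]
    exact le_cosOfCot_of_lt_vertexAngle highAngle_pos h3 ha0 ha1 hβ.1.le hβ.2
  have z3 : ∫ β in vertexAngle lowAngle a..Real.pi, f β = 0 := by
    rw [intervalIntegral.integral_of_le hlepi]
    refine setIntegral_eq_zero_of_forall_eq_zero fun β hβ => cellWeight_of_le ?_
    exact cosOfCot_le_of_vertexAngle_le h0 (by linarith) ha0 ha1 hβ.2 hβ.1.le
  have z2 : ∫ β in vertexAngle highAngle a..vertexAngle lowAngle a, f β = edgeGain a := by
    have : ∫ β in vertexAngle highAngle a..vertexAngle lowAngle a, f β =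
        ∫ β in vertexAngle highAngle a..vertexAngle lowAngle a,
          ((cosOfCot (k * Real.cos β) - lowLevel) * (highLevel - cosOfCot (k * Real.cos β))) := by
      rw [intervalIntegral.integral_of_le hle, intervalIntegral.integral_of_le hle,
        integral_Ioc_eq_integral_Ioo, integral_Ioc_eq_integral_Ioo]
      refine setIntegral_congr_fun measurableSet_Ioo fun β hβ => cellWeight_of_mem ?_ ?_
      · exact le_cosOfCot_of_lt_vertexAngle h0 (by linarith) ha0 ha1 (hge0.trans hβ.1.le) hβ.2
      · rw [← sin_highAngle]
        exact cosOfCot_le_of_vertexAngle_le highAngle_pos h3 ha0 ha1 (hβ.2.le.trans hlepi) hβ.1.le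
    rw [this]
    have hlt : vertexAngle lowAngle a < Real.pi / 2 := by
      apply Real.arccos_lt_pi_div_two.2
      exact mul_pos (tan_pos_of h0 (by linarith)) (tan_pos_of ha0 ha1)
    apply intervalIntegral.integral_eq_sub_of_hasDerivAt (f := arcPrimitive lowLevel highLevel a)
    · intro β hβ
      rw [Set.uIcc_of_le hle] at hβ
      exact hasDerivAt_arcPrimitive _ _ hS
        (Real.cos_pos_of_mem_Ioo ⟨by linarith [hβ.1, Real.pi_pos], by linarith [hβ.2]⟩)
    · have hx : Continuous fun β => cosOfCot (k * Real.cos β) :=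
        continuous_cosOfCot.comp (continuous_const.mul Real.continuous_cos)
      exact ((hx.sub continuous_const).mul (continuous_const.sub hx)).intervalIntegrable _ _
  rw [edgeIntegral, ← intervalIntegral.integral_add_adjacent_intervals (hi _ 0) (hi 0 _), heven,
    ← intervalIntegral.integral_add_adjacent_intervals (hi 0 (vertexAngle highAngle a)) (hi _ _),
    ← intervalIntegral.integral_add_adjacent_intervals
      (hi (vertexAngle highAngle a) (vertexAngle lowAngle a)) (hi _ _), z1, z2, z3]
  ring

lemma edgeIntegral_le {k : ℝ} (hk : 0 ≤ k) : edgeIntegral k ≤ edgeIntegral 1 := by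
  have hp := Real.pi_pos
  rcases hk.eq_or_lt with rfl | hk
  · have : edgeIntegral 0 = 0 := by
      simp [edgeIntegral, cosOfCot, cellWeight_of_le lowLevel_pos.le]
    rw [this]
    exact intervalIntegral.integral_nonneg (by linarith) fun _ _ => cellWeight_nonneg _
  have h4 : edgeIntegral 1 = 2 * edgeGain (Real.pi / 4) := by
    rw [← edgeIntegral_cot (by linarith) (by linarith)]
    simp
  have ha0 : 0 < Real.arctan (1 / k) := Real.arctan_pos.2 (by positivity)
  have ha1 := Real.arctan_lt_pi_div_two (1 / k)
  have hkk : Real.cos (Real.arctan (1 / k)) / Real.sin (Real.arctan (1 / k)) = k := by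
    rw [← inv_div, ← Real.tan_eq_sin_div_cos, Real.tan_arctan, one_div, inv_inv]
  rw [h4]
  nth_rw 1 [← hkk]
  rw [edgeIntegral_cot ha0 ha1]
  linarith [edgeGain_le ha0 ha1]

/-- Amplitude-phase form of a linear combination of cosine and sine. -/
lemma exists_amplitude_phase (x y : ℝ) :
    ∃ φ, ∀ β, Real.cos β * x + Real.sin β * y = √(x ^ 2 + y ^ 2) * Real.cos (β - φ) := by
  refine ⟨Complex.arg ⟨x, y⟩, fun β => ?_⟩
  have hn : √(x ^ 2 + y ^ 2) = ‖(⟨x, y⟩ : ℂ)‖ := by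
    rw [Complex.norm_def, Complex.normSq_mk]; ring_nf
  rw [hn, Real.cos_sub]
  have h1 := Complex.norm_mul_cos_arg ⟨x, y⟩
  have h2 := Complex.norm_mul_sin_arg ⟨x, y⟩
  simp only at h1 h2
  linear_combination -Real.cos β * h1 - Real.sin β * h2

lemma integral_cellWeight_eq (x y : ℝ) :
    ∫ β in -Real.pi..Real.pi, cellWeight (cosOfCot (Real.cos β * x + Real.sin β * y)) =
      edgeIntegral (√(x ^ 2 + y ^ 2)) := by
  obtain ⟨φ, hφ⟩ := exists_amplitude_phase x y
  simp_rw [hφ]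
  set f := fun β => cellWeight (cosOfCot (√(x ^ 2 + y ^ 2) * Real.cos β))
  have hper : Function.Periodic f (2 * Real.pi) := fun β => by
    simp [f, Real.cos_add_two_pi]
  have := intervalIntegral.integral_comp_sub_right (a := -Real.pi) (b := Real.pi) f φ
  have h2 := hper.intervalIntegral_add_eq (-Real.pi - φ) (-Real.pi)
  rw [show -Real.pi - φ + 2 * Real.pi = Real.pi - φ by ring,
    show -Real.pi + 2 * Real.pi = Real.pi by ring] at h2
  rw [edgeIntegral]
  exact this.trans h2

lemma countable_setOf_trig_eq_zero {x y : ℝ} (h : x ≠ 0 ∨ y ≠ 0) :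
    {β | Real.cos β * x + Real.sin β * y = 0}.Countable := by
  obtain ⟨φ, hφ⟩ := exists_amplitude_phase x y
  refine (Set.countable_range fun n : ℤ => φ + (2 * n + 1) * Real.pi / 2).mono fun β hβ => ?_
  rw [Set.mem_ofPred_eq, hφ] at hβ
  have hpos : √(x ^ 2 + y ^ 2) ≠ 0 := by
    apply (Real.sqrt_pos.2 _).ne'
    rcases h with h | h <;> positivity
  obtain ⟨n, hn⟩ := Real.cos_eq_zero_iff.1 ((mul_eq_zero.1 hβ).resolve_left hpos)
  exact ⟨n, by simp only; linarith⟩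

/-- The Gaussian tail integral `∫_s^∞ exp (-z²/2) dz`. -/
def gaussTail (s : ℝ) : ℝ := ∫ z in Set.Ioi s, Real.exp (-(1 / 2) * z ^ 2)

lemma integrable_gauss : Integrable fun z : ℝ => Real.exp (-(1 / 2) * z ^ 2) :=
  integrable_exp_neg_mul_sq (by norm_num)

lemma gaussTail_zero : gaussTail 0 = √(Real.pi / 2) := by
  rw [gaussTail, integral_gaussian_Ioi]
  rw [show Real.pi / (1 / 2) = Real.pi / 2 * 2 ^ 2 by ring, Real.sqrt_mul (by positivity),
    Real.sqrt_sq (by norm_num)]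
  ring

lemma gaussTail_eq (s : ℝ) :
    gaussTail s = gaussTail 0 - ∫ z in (0 : ℝ)..s, Real.exp (-(1 / 2) * z ^ 2) := by
  rw [eq_sub_iff_add_eq, add_comm]
  exact intervalIntegral.integral_interval_add_Ioi' integrable_gauss.intervalIntegrable
    integrable_gauss.integrableOn

lemma hasDerivAt_gaussTail (s : ℝ) :
    HasDerivAt gaussTail (-Real.exp (-(1 / 2) * s ^ 2)) s := by
  rw [show gaussTail = _ from funext gaussTail_eq]
  have hc : Continuous fun z : ℝ => Real.exp (-(1 / 2) * z ^ 2) := by fun_prop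
  exact (intervalIntegral.integral_hasDerivAt_right (hc.intervalIntegrable _ _)
    hc.stronglyMeasurable.stronglyMeasurableAtFilter hc.continuousAt).const_sub _

lemma gaussTail_nonneg (s : ℝ) : 0 ≤ gaussTail s :=
  setIntegral_nonneg measurableSet_Ioi fun _ _ => (Real.exp_pos _).le

lemma gaussTail_le (s : ℝ) : gaussTail s ≤ ∫ z : ℝ, Real.exp (-(1 / 2) * z ^ 2) :=
  setIntegral_le_integral integrable_gauss (ae_of_all _ fun _ => (Real.exp_pos _).le)

lemma tendsto_gauss : Filter.Tendsto (fun z : ℝ => Real.exp (-(1 / 2) * z ^ 2))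
    Filter.atTop (nhds 0) := by
  refine Real.tendsto_exp_atBot.comp ?_
  exact (Filter.tendsto_pow_atTop two_ne_zero).const_mul_atTop_of_neg (by norm_num)

lemma hasDerivAt_gauss (a z : ℝ) : HasDerivAt (fun z : ℝ => Real.exp (-(a / 2) * z ^ 2))
    (-(a * (z * Real.exp (-(a / 2) * z ^ 2)))) z := by
  refine ((hasDerivAt_pow 2 z).const_mul (-(a / 2))).exp.congr_deriv ?_
  norm_num
  ring

lemma integrable_mul_gauss {a : ℝ} (ha : 0 < a) :
    Integrable fun z : ℝ => z * Real.exp (-(a / 2) * z ^ 2) :=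
  integrable_mul_exp_neg_mul_sq (by positivity)

lemma integral_Ioi_mul_gauss {a : ℝ} (ha : 0 < a) (s : ℝ) :
    ∫ z in Set.Ioi s, z * Real.exp (-(a / 2) * z ^ 2) = a⁻¹ * Real.exp (-(a / 2) * s ^ 2) := by
  have h := integral_Ioi_of_hasDerivAt_of_tendsto' (a := s)
    (f := fun z => -a⁻¹ * Real.exp (-(a / 2) * z ^ 2))
    (f' := fun z => z * Real.exp (-(a / 2) * z ^ 2)) (m := -a⁻¹ * 0)
    (fun z _ => by
      refine ((hasDerivAt_gauss a z).const_mul (-a⁻¹)).congr_deriv ?_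
      field_simp)
    (integrable_mul_gauss ha).integrableOn
    (Filter.Tendsto.const_mul _ (Real.tendsto_exp_atBot.comp
      ((Filter.tendsto_pow_atTop two_ne_zero).const_mul_atTop_of_neg (by linarith))))
  rw [h]; ring

lemma integral_Ioi_mul_gaussTail (κ : ℝ) :
    ∫ r in Set.Ioi (0 : ℝ), r * Real.exp (-(1 / 2) * r ^ 2) * gaussTail (r * κ) =
      √(Real.pi / 2) * (1 - κ / √(1 + κ ^ 2)) := by
  have hG : Continuous gaussTail :=
    continuous_iff_continuousAt.2 fun s => (hasDerivAt_gaussTail s).continuousAt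
  have hI1 : Integrable fun r : ℝ => r * Real.exp (-(1 / 2) * r ^ 2) * gaussTail (r * κ) :=
    (integrable_mul_gauss one_pos).mul_bdd (c := ∫ z : ℝ, Real.exp (-(1 / 2) * z ^ 2))
      (by fun_prop) (ae_of_all _ fun r => by
        rw [Real.norm_of_nonneg (gaussTail_nonneg _)]; exact gaussTail_le _)
  have hI2 : Integrable fun r : ℝ => κ * Real.exp (-((1 + κ ^ 2) / 2) * r ^ 2) :=
    (integrable_exp_neg_mul_sq (by positivity)).const_mul _
  have h := integral_Ioi_of_hasDerivAt_of_tendsto' (a := 0)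
    (f := fun r => -(Real.exp (-(1 / 2) * r ^ 2) * gaussTail (r * κ)))
    (f' := fun r => r * Real.exp (-(1 / 2) * r ^ 2) * gaussTail (r * κ) +
      κ * Real.exp (-((1 + κ ^ 2) / 2) * r ^ 2)) (m := -0)
    (fun r _ => by
      have h1 := hasDerivAt_gauss 1 r
      have h2 := (hasDerivAt_gaussTail (r * κ)).comp r ((hasDerivAt_id r).mul_const κ)
      refine (h1.mul h2).neg.congr_deriv ?_
      simp only [Function.comp_apply, one_mul, id]
      rw [show -((1 + κ ^ 2) / 2) * r ^ 2 = -(1 / 2) * r ^ 2 + -(1 / 2) * (r * κ) ^ 2 by ring,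
        Real.exp_add]
      ring)
    (hI1.add hI2).integrableOn
    (by
      refine Filter.Tendsto.neg ?_
      refine squeeze_zero (fun r => mul_nonneg (Real.exp_pos _).le (gaussTail_nonneg _))
        (fun r => mul_le_mul_of_nonneg_left (gaussTail_le _) (Real.exp_pos _).le) ?_
      have h0 := tendsto_gauss.mul_const (∫ z : ℝ, Real.exp (-(1 / 2) * z ^ 2))
      rwa [zero_mul] at h0)
  rw [integral_add hI1.integrableOn hI2.integrableOn, integral_const_mul,
    integral_gaussian_Ioi, ← eq_sub_iff_add_eq] at h
  rw [h]
  have : Real.pi / ((1 + κ ^ 2) / 2) = Real.pi / 2 * (2 ^ 2 / (1 + κ ^ 2)) := by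
    field_simp
  rw [this, Real.sqrt_mul (by positivity), Real.sqrt_div (by positivity) (1 + κ ^ 2),
    Real.sqrt_sq (by norm_num), zero_mul, gaussTail_zero]
  simp only [ne_eq, OfNat.ofNat_ne_zero, not_false_eq_true, zero_pow, mul_zero, Real.exp_zero]
  ring

lemma gaussianPDFReal_zero_one (x : ℝ) :
    gaussianPDFReal 0 1 x = (√(2 * Real.pi))⁻¹ * Real.exp (-(1 / 2) * x ^ 2) := by
  simp [gaussianPDFReal]
  left; ring

lemma integral_gaussianReal_eq (f : ℝ → ℝ) :
    ∫ x, f x ∂(gaussianReal 0 1) =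
      (√(2 * Real.pi))⁻¹ * ∫ x, Real.exp (-(1 / 2) * x ^ 2) * f x := by
  rw [integral_gaussianReal_eq_integral_smul one_ne_zero, ← integral_const_mul]
  simp [gaussianPDFReal_zero_one, mul_assoc]

lemma integral_gaussianReal_indicator (s δ : ℝ) :
    ∫ z, (Set.Ioi s).indicator (fun z => z + δ) z ∂(gaussianReal 0 1) =
      (√(2 * Real.pi))⁻¹ * (Real.exp (-(1 / 2) * s ^ 2) + δ * gaussTail s) := by
  rw [integral_gaussianReal_eq]
  congr 1
  have : (fun z => Real.exp (-(1 / 2) * z ^ 2) * (Set.Ioi s).indicator (fun z => z + δ) z) =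
      (Set.Ioi s).indicator fun z =>
        z * Real.exp (-(1 / 2) * z ^ 2) + δ * Real.exp (-(1 / 2) * z ^ 2) := by
    ext z
    by_cases h : z ∈ Set.Ioi s <;> simp [h]
    ring
  rw [this, integral_indicator measurableSet_Ioi,
    integral_add (integrable_mul_gauss one_pos).integrableOn
      (integrable_gauss.const_mul _).integrableOn, integral_const_mul,
    integral_Ioi_mul_gauss one_pos, gaussTail]
  simp

/-- Integration against the planar standard Gaussian in polar coordinates, for functions of
a positively homogeneous function. -/
lemma integral_gaussian_prod_polar {h : ℝ × ℝ → ℝ} (hc : Continuous h)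
    (hh : ∀ r : ℝ, 0 < r → ∀ x y, h (r * x, r * y) = r * h (x, y))
    {Φ : ℝ → ℝ} (hΦ : Continuous Φ) {C : ℝ} (hC : ∀ s, ‖Φ s‖ ≤ C) :
    ∫ p, Φ (h p) ∂((gaussianReal 0 1).prod (gaussianReal 0 1)) =
      (√(2 * Real.pi))⁻¹ ^ 2 * ∫ β in -Real.pi..Real.pi, ∫ r in Set.Ioi (0 : ℝ),
        r * Real.exp (-(1 / 2) * r ^ 2) * Φ (r * h (Real.cos β, Real.sin β)) := by
  have hΦh : Continuous fun p => Φ (h p) := hΦ.comp hc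
  rw [integral_prod _ (Integrable.of_bound (C := C) hΦh.aestronglyMeasurable
    (ae_of_all _ fun p => hC _))]
  simp_rw [integral_gaussianReal_eq, ← integral_const_mul]
  have hint : Integrable (fun p : ℝ × ℝ => Real.exp (-(1 / 2) * p.1 ^ 2) *
      Real.exp (-(1 / 2) * p.2 ^ 2) * Φ (h p)) (volume.prod volume) :=
    (integrable_gauss.mul_prod integrable_gauss).mul_bdd (c := C)
      hΦh.aestronglyMeasurable (ae_of_all _ fun p => hC _)
  have e1 : ∀ x y : ℝ, (√(2 * Real.pi))⁻¹ * (Real.exp (-(1 / 2) * x ^ 2) *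
      ((√(2 * Real.pi))⁻¹ * (Real.exp (-(1 / 2) * y ^ 2) * Φ (h (x, y))))) =
      (√(2 * Real.pi))⁻¹ ^ 2 * (Real.exp (-(1 / 2) * x ^ 2) *
      Real.exp (-(1 / 2) * y ^ 2) * Φ (h (x, y))) := fun x y => by ring
  simp_rw [e1]
  rw [← integral_prod (fun p : ℝ × ℝ => (√(2 * Real.pi))⁻¹ ^ 2 * (Real.exp (-(1 / 2) * p.1 ^ 2) *
      Real.exp (-(1 / 2) * p.2 ^ 2) * Φ (h p))) (hint.const_mul _), integral_const_mul]
  congr 1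
  rw [← Measure.volume_eq_prod, ← integral_comp_polarCoord_symm]
  have e2 : ∀ p : ℝ × ℝ, p ∈ polarCoord.target → p.1 • (Real.exp (-(1 / 2) *
      (polarCoord.symm p).1 ^ 2) * Real.exp (-(1 / 2) * (polarCoord.symm p).2 ^ 2) *
      Φ (h (polarCoord.symm p))) =
      p.1 * Real.exp (-(1 / 2) * p.1 ^ 2) * Φ (p.1 * h (Real.cos p.2, Real.sin p.2)) := by
    rintro ⟨r, β⟩ hp
    have hr : 0 < r := hp.1
    rw [polarCoord_symm_apply]
    simp only [smul_eq_mul]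
    rw [hh r hr, ← Real.exp_add, ← mul_assoc]
    congr 3
    nlinarith [Real.sin_sq_add_cos_sq β]
  rw [setIntegral_congr_fun polarCoord.open_target.measurableSet e2, polarCoord_target,
    Measure.volume_eq_prod, ← Measure.prod_restrict, integral_prod_symm,
    intervalIntegral.integral_of_le (by linarith [Real.pi_pos]), integral_Ioc_eq_integral_Ioo]
  have h1 : Integrable (fun p : ℝ × ℝ => (p.1 * Real.exp (-(1 / 2) * p.1 ^ 2)) * (1 : ℝ))
      ((volume.restrict (Set.Ioi 0)).prod (volume.restrict (Set.Ioo (-Real.pi) Real.pi))) :=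
    (integrable_mul_gauss one_pos).integrableOn.mul_prod (integrable_const _)
  simp only [mul_one] at h1
  refine h1.mul_bdd (c := C) ?_ (ae_of_all _ fun p => hC _)
  have : Continuous fun p : ℝ × ℝ => Φ (p.1 * h (Real.cos p.2, Real.sin p.2)) := by fun_prop
  exact this.aestronglyMeasurable

/-- The Gaussian integral of `z + δ` over the region above the graph of a positively
homogeneous function. -/
lemma integral_gaussian_cone {h : ℝ × ℝ → ℝ} (hc : Continuous h)
    (hh : ∀ r : ℝ, 0 < r → ∀ x y, h (r * x, r * y) = r * h (x, y)) (δ : ℝ) :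
    ∫ q : ℝ × (ℝ × ℝ), (Set.Ioi (h q.2)).indicator (fun z => z + δ) q.1
      ∂((gaussianReal 0 1).prod ((gaussianReal 0 1).prod (gaussianReal 0 1))) =
    (√(2 * Real.pi))⁻¹ ^ 3 * ∫ β in -Real.pi..Real.pi,
      (1 - (h (Real.cos β, Real.sin β) / √(1 + h (Real.cos β, Real.sin β) ^ 2)) ^ 2 +
        δ * √(Real.pi / 2) *
          (1 - h (Real.cos β, Real.sin β) / √(1 + h (Real.cos β, Real.sin β) ^ 2))) := by
  have hG : Continuous gaussTail :=
    continuous_iff_continuousAt.2 fun s => (hasDerivAt_gaussTail s).continuousAt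
  have hid : Integrable (fun z : ℝ => z) (gaussianReal 0 1) :=
    (memLp_id_gaussianReal 1).integrable le_rfl
  have hm : MeasurableSet {q : ℝ × (ℝ × ℝ) | h q.2 < q.1} :=
    measurableSet_lt (by fun_prop) (by fun_prop)
  have hF : (fun q : ℝ × (ℝ × ℝ) => (Set.Ioi (h q.2)).indicator (fun z => z + δ) q.1) =
      {q : ℝ × (ℝ × ℝ) | h q.2 < q.1}.indicator fun q => q.1 + δ := by
    ext q; simp [Set.indicator]
  have hint : Integrable (fun q : ℝ × (ℝ × ℝ) =>
      (Set.Ioi (h q.2)).indicator (fun z => z + δ) q.1)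
      ((gaussianReal 0 1).prod ((gaussianReal 0 1).prod (gaussianReal 0 1))) := by
    rw [hF]
    exact ((hid.comp_fst _).add (integrable_const δ)).indicator hm
  rw [integral_prod_symm _ hint]
  simp_rw [integral_gaussianReal_indicator]
  rw [integral_const_mul]
  have hb : ∀ s, ‖Real.exp (-(1 / 2) * s ^ 2) + δ * gaussTail s‖ ≤
      1 + |δ| * ∫ z : ℝ, Real.exp (-(1 / 2) * z ^ 2) := fun s => by
    refine (norm_add_le _ _).trans (add_le_add ?_ ?_)
    · rw [Real.norm_of_nonneg (Real.exp_pos _).le, Real.exp_le_one_iff]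
      nlinarith [sq_nonneg s]
    · rw [norm_mul, Real.norm_of_nonneg (gaussTail_nonneg _)]
      exact mul_le_mul_of_nonneg_left (gaussTail_le _) (abs_nonneg _)
  rw [integral_gaussian_prod_polar hc hh (Φ := fun s => Real.exp (-(1 / 2) * s ^ 2) +
    δ * gaussTail s) (by fun_prop) hb, ← mul_assoc]
  congr 1
  · ring
  refine intervalIntegral.integral_congr fun β _ => ?_
  set κ := h (Real.cos β, Real.sin β)
  have hk : (0 : ℝ) < 1 + κ ^ 2 := by positivity
  have hI1 : Integrable fun r : ℝ => r * Real.exp (-((1 + κ ^ 2) / 2) * r ^ 2) :=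
    integrable_mul_gauss hk
  have hI2 : Integrable fun r : ℝ => δ * (r * Real.exp (-(1 / 2) * r ^ 2) * gaussTail (r * κ)) :=
    ((integrable_mul_gauss one_pos).mul_bdd (c := ∫ z : ℝ, Real.exp (-(1 / 2) * z ^ 2))
      (by fun_prop) (ae_of_all _ fun r => by
        rw [Real.norm_of_nonneg (gaussTail_nonneg _)]; exact gaussTail_le _)).const_mul _
  have e : ∀ r : ℝ, r * Real.exp (-(1 / 2) * r ^ 2) * (Real.exp (-(1 / 2) * (r * κ) ^ 2) +
      δ * gaussTail (r * κ)) = r * Real.exp (-((1 + κ ^ 2) / 2) * r ^ 2) +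
      δ * (r * Real.exp (-(1 / 2) * r ^ 2) * gaussTail (r * κ)) := fun r => by
    rw [show -((1 + κ ^ 2) / 2) * r ^ 2 = -(1 / 2) * r ^ 2 + -(1 / 2) * (r * κ) ^ 2 by ring,
        Real.exp_add]
    ring
  rw [setIntegral_congr_fun measurableSet_Ioi fun r _ => e r]
  rw [integral_add hI1.integrableOn hI2.integrableOn, integral_const_mul,
    integral_Ioi_mul_gaussTail, integral_Ioi_mul_gauss hk, div_pow, Real.sq_sqrt hk.le]
  simp only [ne_eq, OfNat.ofNat_ne_zero, not_false_eq_true, zero_pow, mul_zero, Real.exp_zero]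
  field_simp
  ring

lemma measurePreserving_pi_three (μ : Measure ℝ) [SigmaFinite μ] :
    MeasurePreserving (fun x : Fin 3 → ℝ => (x 0, (x 1, x 2)))
      (Measure.pi fun _ : Fin 3 => μ) (μ.prod (μ.prod μ)) := by
  have h1 := measurePreserving_piFinSuccAbove (fun _ : Fin 3 => μ) 0
  have h2 := (measurePreserving_piFinTwo (fun _ : Fin 2 => μ))
  exact ((MeasurePreserving.id μ).prod h2).comp h1

lemma exists_orthonormalBasis_of_norm_eq_one {w : EuclideanSpace ℝ (Fin 3)} (hw : ‖w‖ = 1) :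
    ∃ b : OrthonormalBasis (Fin 3) ℝ (EuclideanSpace ℝ (Fin 3)), b 0 = w := by
  obtain ⟨b, hb⟩ := Orthonormal.exists_orthonormalBasis_extension_of_card_eq
    (𝕜 := ℝ) (E := EuclideanSpace ℝ (Fin 3)) (ι := Fin 3) (by simp) (v := fun _ => w) (s := {0})
    ⟨fun _ => hw, fun i j hij => (hij (Subsingleton.elim i j)).elim⟩
  exact ⟨b, hb 0 rfl⟩

/-- The slope, as a function of the direction `p` in the plane spanned by `b 1` and `b 2`, of
the bisector between the pole `b 0` and the vector `w`. -/
def edgeSlope (b : OrthonormalBasis (Fin 3) ℝ (EuclideanSpace ℝ (Fin 3)))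
    (w : EuclideanSpace ℝ (Fin 3)) (p : ℝ × ℝ) : ℝ :=
  (p.1 * inner ℝ (b 1) w + p.2 * inner ℝ (b 2) w) / (1 - inner ℝ (b 0) w)

lemma erase_nonempty {ι : Type*} [Fintype ι] [DecidableEq ι] [Nontrivial ι] (i : ι) :
    (Finset.univ.erase i).Nonempty := by
  obtain ⟨j, hj⟩ := exists_ne i
  exact ⟨j, by simp [hj]⟩

section Cells

variable {ι : Type*}

/-- The largest slope of the bisectors bounding the cell of `v i`. -/
def maxSlope [Fintype ι] [DecidableEq ι] [Nontrivial ι]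
    (b : OrthonormalBasis (Fin 3) ℝ (EuclideanSpace ℝ (Fin 3)))
    (v : ι → EuclideanSpace ℝ (Fin 3)) (i : ι) (p : ℝ × ℝ) : ℝ :=
  (Finset.univ.erase i).sup' (erase_nonempty i) fun j => edgeSlope b (v j) p

lemma continuous_edgeSlope (b : OrthonormalBasis (Fin 3) ℝ (EuclideanSpace ℝ (Fin 3)))
    (w : EuclideanSpace ℝ (Fin 3)) : Continuous (edgeSlope b w) := by
  unfold edgeSlope; fun_prop

lemma continuous_maxSlope [Fintype ι] [DecidableEq ι] [Nontrivial ι]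
    (b : OrthonormalBasis (Fin 3) ℝ (EuclideanSpace ℝ (Fin 3)))
    (v : ι → EuclideanSpace ℝ (Fin 3)) (i : ι) : Continuous (maxSlope b v i) :=
  Continuous.finset_sup'_apply _ fun j _ => continuous_edgeSlope b (v j)

lemma edgeSlope_mul (b : OrthonormalBasis (Fin 3) ℝ (EuclideanSpace ℝ (Fin 3)))
    (w : EuclideanSpace ℝ (Fin 3)) (r x y : ℝ) :
    edgeSlope b w (r * x, r * y) = r * edgeSlope b w (x, y) := by
  simp only [edgeSlope]; ring

lemma maxSlope_mul [Fintype ι] [DecidableEq ι] [Nontrivial ι]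
    (b : OrthonormalBasis (Fin 3) ℝ (EuclideanSpace ℝ (Fin 3)))
    (v : ι → EuclideanSpace ℝ (Fin 3)) (i : ι) (r : ℝ) (hr : 0 < r) (x y : ℝ) :
    maxSlope b v i (r * x, r * y) = r * maxSlope b v i (x, y) := by
  simp only [maxSlope, edgeSlope_mul]
  exact (Finset.apply_sup'_eq_sup'_comp _ (fun z => r * z)
    (fun x y => mul_max_of_nonneg x y hr.le)).symm

lemma edgeSlope_lt_iff (b : OrthonormalBasis (Fin 3) ℝ (EuclideanSpace ℝ (Fin 3)))
    {w : EuclideanSpace ℝ (Fin 3)} (hw : inner ℝ (b 0) w < 1) (x : Fin 3 → ℝ) :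
    edgeSlope b w (x 1, x 2) < x 0 ↔
      inner ℝ w (∑ k, x k • b k) < inner ℝ (b 0) (∑ k, x k • b k) := by
  have h0 : inner ℝ (b 0) (∑ k, x k • b k) = x 0 := by
    simp [Fin.sum_univ_three, inner_add_right, inner_smul_right,
      orthonormal_iff_ite.1 b.orthonormal]
  rw [h0, edgeSlope, div_lt_iff₀ (by linarith)]
  simp only [Fin.sum_univ_three, inner_add_right, inner_smul_right, real_inner_comm w]
  constructor <;> intro h <;> linarith

lemma maxSlope_lt_iff [Fintype ι] [DecidableEq ι] [Nontrivial ι]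
    {b : OrthonormalBasis (Fin 3) ℝ (EuclideanSpace ℝ (Fin 3))}
    {v : ι → EuclideanSpace ℝ (Fin 3)} {i : ι} (hb : b 0 = v i)
    (hv : ∀ j, j ≠ i → inner ℝ (v i) (v j) < 1) (x : Fin 3 → ℝ) :
    maxSlope b v i (x 1, x 2) < x 0 ↔
      ∀ j, j ≠ i → inner ℝ (v j) (∑ k, x k • b k) < inner ℝ (v i) (∑ k, x k • b k) := by
  rw [maxSlope, Finset.sup'_lt_iff]
  refine forall_congr' fun j => ?_
  simp only [Finset.mem_erase, Finset.mem_univ, and_true]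
  refine forall_congr' fun hj => ?_
  rw [edgeSlope_lt_iff b (by rw [hb]; exact hv j hj), hb]

/-- The open normal cone of `v i`: where `v i` is the strict maximiser. -/
def strictCell (v : ι → EuclideanSpace ℝ (Fin 3)) (i : ι) : Set (EuclideanSpace ℝ (Fin 3)) :=
  {u | ∀ j, j ≠ i → inner ℝ (v j) u < inner ℝ (v i) u}

lemma measurableSet_strictCell [Finite ι] (v : ι → EuclideanSpace ℝ (Fin 3)) (i : ι) :
    MeasurableSet (strictCell v i) := by
  have : strictCell v i = ⋂ j, ⋂ (_ : j ≠ i), {u | inner ℝ (v j) u < inner ℝ (v i) u} := by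
    ext; simp [strictCell]
  rw [this]
  refine MeasurableSet.iInter fun j => MeasurableSet.iInter fun _ => ?_
  exact measurableSet_lt (by fun_prop) (by fun_prop)

/-- The shift making the Gaussian cell integral factor through the two levels. -/
def levelShift : ℝ := -(lowLevel + highLevel) / √(Real.pi / 2)

lemma integral_strictCell [Fintype ι] [DecidableEq ι] [Nontrivial ι]
    {b : OrthonormalBasis (Fin 3) ℝ (EuclideanSpace ℝ (Fin 3))}
    {v : ι → EuclideanSpace ℝ (Fin 3)} {i : ι} (hb : b 0 = v i)
    (hv : ∀ j, j ≠ i → inner ℝ (v i) (v j) < 1) :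
    ∫ u, (strictCell v i).indicator (fun u => inner ℝ (v i) u + levelShift) u
        ∂(stdGaussian (EuclideanSpace ℝ (Fin 3))) =
      (√(2 * Real.pi))⁻¹ ^ 3 * ∫ β in -Real.pi..Real.pi,
        ((cosOfCot (maxSlope b v i (Real.cos β, Real.sin β)) - lowLevel) *
          (highLevel - cosOfCot (maxSlope b v i (Real.cos β, Real.sin β))) +
          (1 - lowLevel) * (1 - highLevel)) := by
  have hmeas : Measurable fun u : EuclideanSpace ℝ (Fin 3) =>
      (strictCell v i).indicator (fun u => inner ℝ (v i) u + levelShift) u :=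
    Measurable.indicator (by fun_prop) (measurableSet_strictCell v i)
  rw [stdGaussian_eq_map_pi_orthonormalBasis b,
    integral_map (Continuous.aemeasurable (by fun_prop)) hmeas.aestronglyMeasurable]
  have e : ∀ x : Fin 3 → ℝ, (strictCell v i).indicator
      (fun u => inner ℝ (v i) u + levelShift) (∑ k, x k • b k) =
      (Set.Ioi (maxSlope b v i (x 1, x 2))).indicator (fun z => z + levelShift) (x 0) := by
    intro x
    have h0 : inner ℝ (v i) (∑ k, x k • b k) = x 0 := by
      rw [← hb]
      simp [Fin.sum_univ_three, inner_add_right, inner_smul_right,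
        orthonormal_iff_ite.1 b.orthonormal]
    have hiff := maxSlope_lt_iff hb hv x
    by_cases h : maxSlope b v i (x 1, x 2) < x 0
    · rw [Set.indicator_of_mem (show _ ∈ strictCell v i from hiff.1 h),
        Set.indicator_of_mem (show _ ∈ Set.Ioi _ from h), h0]
    · rw [Set.indicator_of_notMem (fun hx : _ ∈ strictCell v i => h (hiff.2 hx)),
        Set.indicator_of_notMem (show _ ∉ Set.Ioi _ from h)]
  simp_rw [e]
  have hm : MeasurableSet {q : ℝ × (ℝ × ℝ) | maxSlope b v i q.2 < q.1} :=
    measurableSet_lt ((continuous_maxSlope b v i).measurable.comp measurable_snd) measurable_fst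
  have hF : (fun q : ℝ × (ℝ × ℝ) =>
      (Set.Ioi (maxSlope b v i q.2)).indicator (fun z => z + levelShift) q.1) =
      {q : ℝ × (ℝ × ℝ) | maxSlope b v i q.2 < q.1}.indicator fun q => q.1 + levelShift := by
    ext q; simp [Set.indicator]
  have h1 := integral_map (μ := Measure.pi fun _ : Fin 3 => gaussianReal 0 1)
    (measurePreserving_pi_three (gaussianReal 0 1)).measurable.aemeasurable
    (f := fun q : ℝ × (ℝ × ℝ) =>
      (Set.Ioi (maxSlope b v i q.2)).indicator (fun z => z + levelShift) q.1)
    (by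
      rw [hF]
      exact (Measurable.indicator (by fun_prop) hm).aestronglyMeasurable)
  rw [(measurePreserving_pi_three (gaussianReal 0 1)).map_eq] at h1
  rw [← h1, integral_gaussian_cone (continuous_maxSlope b v i) (maxSlope_mul b v i)]
  congr 1
  refine intervalIntegral.integral_congr fun β _ => ?_
  have : levelShift * √(Real.pi / 2) = -(lowLevel + highLevel) :=
    div_mul_cancel₀ _ (Real.sqrt_pos.2 (by positivity)).ne'
  simp only [cosOfCot_eq, this]
  ring

lemma stdGaussian_hyperplane_eq_zero {w : EuclideanSpace ℝ (Fin 3)} (hw : w ≠ 0) :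
    ∀ᵐ u ∂(stdGaussian (EuclideanSpace ℝ (Fin 3))), inner ℝ w u ≠ 0 := by
  have h := IsGaussian.map_eq_gaussianReal (μ := stdGaussian (EuclideanSpace ℝ (Fin 3)))
    (innerSL ℝ w)
  rw [variance_dual_stdGaussian, innerSL_apply_norm] at h
  have hv : (‖w‖ ^ 2).toNNReal ≠ 0 := by
    simpa [Real.toNNReal_eq_zero] using hw
  have : NullSingletonClass ((stdGaussian (EuclideanSpace ℝ (Fin 3))).map (innerSL ℝ w)) := by
    rw [h]; exact nullSingletonClass_gaussianReal hv
  have h2 : ∀ᵐ t ∂((stdGaussian (EuclideanSpace ℝ (Fin 3))).map (innerSL ℝ w)), t ≠ 0 := by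
    simpa [ae_iff] using this.measure_singleton 0
  exact ae_of_ae_map (p := fun t => t ≠ 0) (innerSL ℝ w).continuous.aemeasurable h2

/-- The expected maximum of the linear functionals `v i` on a standard Gaussian vector. -/
def meanWidth (v : ι → EuclideanSpace ℝ (Fin 3)) : ℝ :=
  ∫ u, (⨆ i, inner ℝ (v i) u) ∂(stdGaussian (EuclideanSpace ℝ (Fin 3)))

lemma integrable_inner_stdGaussian (w : EuclideanSpace ℝ (Fin 3)) :
    Integrable (fun u => inner ℝ w u) (stdGaussian (EuclideanSpace ℝ (Fin 3))) :=
  IsGaussian.integrable_dual _ (innerSL ℝ w)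

lemma meanWidth_add_levelShift [Fintype ι] [Nonempty ι] {v : ι → EuclideanSpace ℝ (Fin 3)}
    (hv : Function.Injective v) :
    meanWidth v + levelShift =
      ∑ i, ∫ u, (strictCell v i).indicator (fun u => inner ℝ (v i) u + levelShift) u
        ∂(stdGaussian (EuclideanSpace ℝ (Fin 3))) := by
  have hae : ∀ᵐ u ∂(stdGaussian (EuclideanSpace ℝ (Fin 3))), ∀ i j, i ≠ j →
      inner ℝ (v i) u ≠ inner ℝ (v j) u := by
    refine ae_all_iff.2 fun i => ae_all_iff.2 fun j => ?_
    by_cases hij : i = j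
    · exact ae_of_all _ fun u h => (h hij).elim
    · filter_upwards [stdGaussian_hyperplane_eq_zero (sub_ne_zero.2 (hv.ne hij))] with u hu _
      rwa [inner_sub_left, sub_ne_zero] at hu
  have hint : ∀ i, Integrable ((strictCell v i).indicator
      fun u => inner ℝ (v i) u + levelShift) (stdGaussian (EuclideanSpace ℝ (Fin 3))) :=
    fun i => ((integrable_inner_stdGaussian _).add (integrable_const _)).indicator
      (measurableSet_strictCell v i)
  have hsum : (fun u => ∑ i, (strictCell v i).indicator
      (fun u => inner ℝ (v i) u + levelShift) u) =ᵐ[stdGaussian (EuclideanSpace ℝ (Fin 3))]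
      fun u => (⨆ i, inner ℝ (v i) u) + levelShift := by
    filter_upwards [hae] with u hu
    obtain ⟨i, hi⟩ := exists_eq_ciSup_of_finite (f := fun i => inner ℝ (v i) u)
    have hle : ∀ j, inner ℝ (v j) u ≤ inner ℝ (v i) u := fun j => by
      rw [hi]; exact le_ciSup (f := fun i => inner ℝ (v i) u) (Set.finite_range _).bddAbove j
    have hi' : u ∈ strictCell v i := fun j hj => lt_of_le_of_ne (hle j) (hu j i hj)
    rw [Finset.sum_eq_single i, Set.indicator_of_mem hi', hi]
    · intro j _ hj
      exact Set.indicator_of_notMem (fun hj' => (hj' i hj.symm).not_ge (hle j)) _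
    · simp
  rw [← integral_finsetSum _ fun i _ => hint i, integral_congr_ae hsum,
    integral_add _ (integrable_const _)]
  · simp [meanWidth]
  · have := (integrable_finsetSum Finset.univ fun i _ => hint i).congr hsum
    convert this.sub (integrable_const levelShift) using 1
    ext u
    simp

end Cells

/-- The set of indices where `l` is positive. -/
def posSet (l : Fin 6 → ℝ) : Finset (Fin 6) := Finset.univ.filter fun k => 0 < l k

lemma mem_posSet {l : Fin 6 → ℝ} {k : Fin 6} : k ∈ posSet l ↔ 0 < l k := by simp [posSet]

section SignPatterns

variable {D : Submodule ℝ (Fin 6 → ℝ)}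

lemma two_le_card_posSet
    (hD : ∀ l ∈ D, ∀ i, (∀ k, k ≠ i → l k ≤ 0) → l = 0)
    {l : Fin 6 → ℝ} (hl : l ∈ D) (h0 : l ≠ 0) : 2 ≤ (posSet l).card := by
  by_contra! h
  have h1 : (posSet l).card ≤ 1 := by omega
  obtain ⟨i, hi⟩ := Finset.card_le_one_iff_subset_singleton.1 h1
  refine h0 (hD l hl i fun k hk => ?_)
  by_contra! hpos
  exact hk (by simpa using hi (mem_posSet.2 hpos))

/-- The two-element positive parts of the elements of `D`. -/
def positivePairs (D : Submodule ℝ (Fin 6 → ℝ)) : Set (Finset (Fin 6)) :=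
  {s | s.card = 2 ∧ ∃ l ∈ D, posSet l = s}

lemma posSet_mem_positivePairs
    (hD : ∀ l ∈ D, ∀ i, (∀ k, k ≠ i → l k ≤ 0) → l = 0)
    {l : Fin 6 → ℝ} (hl : l ∈ D) (h0 : l ≠ 0) {t : Finset (Fin 6)}
    (ht : posSet l ⊆ t) (hc : t.card ≤ 2) : posSet l ∈ positivePairs D :=
  ⟨le_antisymm ((Finset.card_le_card ht).trans hc) (two_le_card_posSet hD hl h0), l, hl, rfl⟩

lemma exists_positivePairs_avoiding
    (hD : ∀ l ∈ D, ∀ i, (∀ k, k ≠ i → l k ≤ 0) → l = 0)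
    (hx : ∀ x, ∃ l ∈ D, l ≠ 0 ∧ l x = 0) (x : Fin 6) :
    ∃ l ∈ D, l ≠ 0 ∧ l x = 0 ∧ posSet l ∈ positivePairs D := by
  obtain ⟨l, hl, h0, hlx⟩ := hx x
  have hn : -l ≠ 0 := neg_ne_zero.2 h0
  have h1 := two_le_card_posSet hD hl h0
  have h2 := two_le_card_posSet hD (D.neg_mem hl) hn
  have hdisj : Disjoint (posSet l) (posSet (-l)) := Finset.disjoint_left.2 fun k hk hk' => by
    rw [mem_posSet] at hk hk'
    simp only [Pi.neg_apply] at hk'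
    linarith
  have hsub : posSet l ∪ posSet (-l) ⊆ Finset.univ.erase x := fun k hk => by
    simp only [Finset.mem_erase, Finset.mem_univ, and_true]
    rintro rfl
    simp [mem_posSet, hlx] at hk
  have hcard := Finset.card_le_card hsub
  rw [Finset.card_union_of_disjoint hdisj, Finset.card_erase_of_mem (Finset.mem_univ x)] at hcard
  simp only [Finset.card_univ, Fintype.card_fin] at hcard
  rcases (by omega : (posSet l).card ≤ 2 ∨ (posSet (-l)).card ≤ 2) with h | h
  · exact ⟨l, hl, h0, hlx, posSet_mem_positivePairs hD hl h0 subset_rfl h⟩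
  · exact ⟨-l, D.neg_mem hl, hn, by simp [hlx],
      posSet_mem_positivePairs hD (D.neg_mem hl) hn subset_rfl h⟩

lemma exists_three_positivePairs
    (hD : ∀ l ∈ D, ∀ i, (∀ k, k ≠ i → l k ≤ 0) → l = 0)
    (hx : ∀ x, ∃ l ∈ D, l ≠ 0 ∧ l x = 0) :
    ∃ e ∈ positivePairs D, ∃ f ∈ positivePairs D, ∃ g ∈ positivePairs D,
      e ≠ f ∧ e ≠ g ∧ f ≠ g := by
  have avoid := exists_positivePairs_avoiding hD hx
  obtain ⟨l₀, hl₀, -, -, he⟩ := avoid 0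
  obtain ⟨p, q, hpq, hpq'⟩ := Finset.card_eq_two.1 he.1
  rw [hpq'] at he
  obtain ⟨l, hl, hl0, hlp, hf⟩ := avoid p
  have hef : ({p, q} : Finset (Fin 6)) ≠ posSet l := fun h => by
    have : p ∈ posSet l := h ▸ by simp
    exact (mem_posSet.1 this).ne' hlp
  by_cases hq : q ∈ posSet l
  · obtain ⟨m, hm, hm0, hmq, hg⟩ := avoid q
    have hqm : q ∉ posSet m := fun h => (mem_posSet.1 h).ne' hmq
    exact ⟨_, he, _, hf, _, hg, hef, fun h => hqm (h ▸ by simp), fun h => hqm (h ▸ hq)⟩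
  obtain ⟨r, s, hrs, hrs'⟩ := Finset.card_eq_two.1 hf.1
  have hr : 0 < l r := mem_posSet.1 (hrs' ▸ by simp)
  have hs : 0 < l s := mem_posSet.1 (hrs' ▸ by simp)
  have hlnp : ∀ k, k ≠ r → k ≠ s → l k ≤ 0 := fun k h1 h2 => by
    by_contra! h
    have := mem_posSet.2 h
    rw [hrs'] at this
    simp [h1, h2] at this
  have hqr : q ≠ r := fun h => hq (h ▸ mem_posSet.2 hr)
  have hqs : q ≠ s := fun h => hq (h ▸ mem_posSet.2 hs)
  have hpr : p ≠ r := fun h => by rw [h] at hlp; linarith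
  have hps : p ≠ s := fun h => by rw [h] at hlp; linarith
  obtain ⟨m, hm, hm0, hmr, hg⟩ := avoid r
  have hfg : posSet l ≠ posSet m := fun h =>
    (mem_posSet.1 (h ▸ mem_posSet.2 hr : r ∈ posSet m)).ne' hmr
  by_cases heg : ({p, q} : Finset (Fin 6)) = posSet m
  swap
  · exact ⟨_, he, _, hf, _, hg, hef, heg, hfg⟩
  have hmp : 0 < m p := mem_posSet.1 (heg ▸ by simp)
  have hmq : 0 < m q := mem_posSet.1 (heg ▸ by simp)
  have hmnp : ∀ k, k ≠ p → k ≠ q → m k ≤ 0 := fun k h1 h2 => by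
    by_contra! h
    have := mem_posSet.2 h
    rw [← heg] at this
    simp [h1, h2] at this
  have hnl : -l ≠ 0 := neg_ne_zero.2 hl0
  by_cases hn2 : (posSet (-l)).card ≤ 2
  · refine ⟨_, he, _, hf, _, posSet_mem_positivePairs hD (D.neg_mem hl) hnl subset_rfl hn2,
      hef, fun h => ?_, fun h => ?_⟩
    · have := mem_posSet.1 (h ▸ (by simp) : p ∈ posSet (-l))
      simp [hlp] at this
    · have := mem_posSet.1 (h ▸ mem_posSet.2 hr : r ∈ posSet (-l))
      simp only [Pi.neg_apply] at this
      linarith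
  have hneg : ∀ k, k ≠ p → k ≠ r → k ≠ s → l k < 0 := by
    have hsub : posSet (-l) ⊆ Finset.univ \ {p, r, s} := fun k hk => by
      rw [mem_posSet] at hk
      simp only [Pi.neg_apply, Left.neg_pos_iff] at hk
      simp only [Finset.mem_sdiff, Finset.mem_univ, true_and, Finset.mem_insert,
        Finset.mem_singleton, not_or]
      refine ⟨?_, ?_, ?_⟩ <;> rintro rfl <;> linarith
    have hc : (Finset.univ \ {p, r, s} : Finset (Fin 6)).card = 3 := by
      rw [Finset.card_sdiff_of_subset (Finset.subset_univ _), Finset.card_eq_three.2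
        ⟨p, r, s, hpr, hps, hrs, rfl⟩]
      rfl
    have heq := Finset.eq_of_subset_of_card_le hsub (by omega)
    intro k h1 h2 h3
    have : k ∈ posSet (-l) := by rw [heq]; simp [h1, h2, h3]
    simpa using mem_posSet.1 this
  have hlq : l q < 0 := hneg q hpq.symm hqr hqs
  set n : Fin 6 → ℝ := m q • l - l q • m with hn
  have hnD : n ∈ D := D.sub_mem (D.smul_mem _ hl) (D.smul_mem _ hm)
  have hnv : ∀ k, n k = m q * l k - l q * m k := fun k => by simp [hn]
  have hnq : n q = 0 := by rw [hnv]; ring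
  have hnp : 0 < n p := by rw [hnv, hlp]; nlinarith
  have hnr : 0 < n r := by rw [hnv, hmr]; nlinarith
  have hn0 : n ≠ 0 := fun h => by rw [h] at hnp; simp at hnp
  have hno : ∀ k, k ≠ p → k ≠ q → k ≠ r → k ≠ s → n k < 0 := fun k h1 h2 h3 h4 => by
    rw [hnv]
    nlinarith [hneg k h1 h3 h4, hmnp k h1 h2]
  by_cases hns : n s ≤ 0
  · have hsub : posSet n ⊆ {p, r} := fun k hk => by
      rw [mem_posSet] at hk
      by_contra hk'
      simp only [Finset.mem_insert, Finset.mem_singleton, not_or] at hk'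
      by_cases hkq : k = q
      · rw [hkq] at hk; linarith
      by_cases hks : k = s
      · rw [hks] at hk; linarith
      exact (hno k hk'.1 hkq hk'.2 hks).not_gt hk
    refine ⟨_, he, _, hf, _, posSet_mem_positivePairs hD hnD hn0 hsub Finset.card_le_two, hef,
      fun h => ?_, fun h => ?_⟩
    · have : r ∈ ({p, q} : Finset (Fin 6)) := h ▸ mem_posSet.2 hnr
      simp [hpr.symm, hqr.symm] at this
    · exact (mem_posSet.1 (h ▸ mem_posSet.2 hnp : p ∈ posSet l)).ne' hlp
  · push Not at hns
    have hsub : posSet (-n) ⊆ Finset.univ \ {p, q, r, s} := fun k hk => by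
      rw [mem_posSet] at hk
      simp only [Pi.neg_apply, Left.neg_pos_iff] at hk
      simp only [Finset.mem_sdiff, Finset.mem_univ, true_and, Finset.mem_insert,
        Finset.mem_singleton, not_or]
      refine ⟨?_, ?_, ?_, ?_⟩ <;> rintro rfl <;> linarith
    have hc : (Finset.univ \ {p, q, r, s} : Finset (Fin 6)).card ≤ 2 := by
      rw [Finset.card_sdiff_of_subset (Finset.subset_univ _)]
      rw [Finset.card_insert_of_notMem (by simp [hpq, hpr, hps]),
        Finset.card_insert_of_notMem (by simp [hqr, hqs]),
        Finset.card_insert_of_notMem (by simp [hrs])]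
      simp
    refine ⟨_, he, _, hf, _, posSet_mem_positivePairs hD (D.neg_mem hnD) (neg_ne_zero.2 hn0)
      hsub hc, hef, fun h => ?_, fun h => ?_⟩
    · have := mem_posSet.1 (h ▸ (by simp) : p ∈ posSet (-n))
      simp only [Pi.neg_apply] at this
      linarith
    · have := mem_posSet.1 (h ▸ mem_posSet.2 hr : r ∈ posSet (-n))
      simp only [Pi.neg_apply] at this
      linarith

end SignPatterns

/-- The affine relations between the points `v k`. -/
def affineRelations (v : Fin 6 → EuclideanSpace ℝ (Fin 3)) : Submodule ℝ (Fin 6 → ℝ) :=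
  LinearMap.ker ((Fintype.linearCombination ℝ v).prod
    (Fintype.linearCombination ℝ fun _ : Fin 6 => (1 : ℝ)))

lemma mem_affineRelations {v : Fin 6 → EuclideanSpace ℝ (Fin 3)} {l : Fin 6 → ℝ} :
    l ∈ affineRelations v ↔ ∑ k, l k • v k = 0 ∧ ∑ k, l k = 0 := by
  simp [affineRelations, Fintype.linearCombination_apply]

lemma exists_affineRelations_eq_zero (v : Fin 6 → EuclideanSpace ℝ (Fin 3)) (x : Fin 6) :
    ∃ l ∈ affineRelations v, l ≠ 0 ∧ l x = 0 := by
  have h := LinearMap.ker_ne_bot_of_finrank_lt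
    (f := ((Fintype.linearCombination ℝ v).prod
      (Fintype.linearCombination ℝ fun _ : Fin 6 => (1 : ℝ))).prod
      (LinearMap.proj (R := ℝ) (φ := fun _ : Fin 6 => ℝ) x)) (by simp)
  obtain ⟨l, hl, h0⟩ := Submodule.exists_mem_ne_zero_of_ne_bot h
  rw [LinearMap.ker_prod] at hl
  exact ⟨l, hl.1, h0, hl.2⟩

lemma inner_lt_one_of_injective {ι : Type*} {v : ι → EuclideanSpace ℝ (Fin 3)}
    (hv : ∀ i, ‖v i‖ = 1) (hinj : Function.Injective v) {i j : ι} (h : j ≠ i) :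
    inner ℝ (v i) (v j) < 1 :=
  (inner_lt_one_iff_real_of_norm_eq_one (hv i) (hv j)).2 (hinj.ne h.symm)

/-- Weights `l k * (1 - ⟪v i, v k⟫)` of an affine relation sum to zero. -/
lemma sum_mul_one_sub_inner {v : Fin 6 → EuclideanSpace ℝ (Fin 3)} {l : Fin 6 → ℝ}
    (hl : l ∈ affineRelations v) (w : EuclideanSpace ℝ (Fin 3)) :
    ∑ k, l k * (1 - inner ℝ w (v k)) = 0 ∧ ∑ k, l k * inner ℝ w (v k) = 0 := by
  obtain ⟨h1, h2⟩ := mem_affineRelations.1 hl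
  have h3 : ∑ k, l k * inner ℝ w (v k) = 0 := by
    have := congrArg (inner ℝ w) h1
    simpa [inner_sum, inner_smul_right] using this
  refine ⟨?_, h3⟩
  simp only [mul_sub, mul_one, Finset.sum_sub_distrib, h2, h3, sub_zero]

lemma affineRelations_eq_zero {v : Fin 6 → EuclideanSpace ℝ (Fin 3)}
    (hv : ∀ i, ‖v i‖ = 1) (hinj : Function.Injective v) (l : Fin 6 → ℝ)
    (hl : l ∈ affineRelations v) (i : Fin 6) (h : ∀ k, k ≠ i → l k ≤ 0) : l = 0 := by
  have h1 := (sum_mul_one_sub_inner hl (v i)).1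
  have hk : ∀ k, k ≠ i → l k = 0 := fun k hk => by
    have hle : ∀ k ∈ Finset.univ, l k * (1 - inner ℝ (v i) (v k)) ≤ 0 := fun k _ => by
      by_cases hk : k = i
      · rw [hk, real_inner_self_eq_norm_sq, hv]; simp
      · exact mul_nonpos_of_nonpos_of_nonneg (h k hk)
          (sub_nonneg.2 (inner_lt_one_of_injective hv hinj hk).le)
    have := (Finset.sum_eq_zero_iff_of_nonpos hle).1 h1 k (Finset.mem_univ k)
    rcases mul_eq_zero.1 this with h | h
    · exact h
    · linarith [inner_lt_one_of_injective hv hinj hk]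
  have hi : l i = 0 := by
    have := (mem_affineRelations.1 hl).2
    rwa [Finset.sum_eq_single i (fun k _ h => hk k h) (by simp)] at this
  ext k
  by_cases h : k = i
  · rw [h, hi]; rfl
  · exact hk k h

/-- The ordered pairs that do not form the positive part of an affine relation. -/
def edgePairs (v : Fin 6 → EuclideanSpace ℝ (Fin 3)) : Finset (Fin 6 × Fin 6) :=
  open Classical in
  Finset.univ.filter fun p => p.1 ≠ p.2 ∧ {p.1, p.2} ∉ positivePairs (affineRelations v)

lemma card_edgePairs_le {v : Fin 6 → EuclideanSpace ℝ (Fin 3)}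
    (hv : ∀ i, ‖v i‖ = 1) (hinj : Function.Injective v) : (edgePairs v).card ≤ 24 := by
  obtain ⟨e, he, f, hf, g, hg, hef, heg, hfg⟩ := exists_three_positivePairs
    (affineRelations_eq_zero hv hinj) (exists_affineRelations_eq_zero v)
  have hpair : ∀ {s : Finset (Fin 6)}, s.card = 2 → ∀ p ∈ s.offDiag, {p.1, p.2} = s :=
    fun {s} hs p hp => by
      rw [Finset.mem_offDiag] at hp
      refine Finset.eq_of_subset_of_card_le ?_ ?_
      · simp [Finset.insert_subset_iff, hp.1, hp.2.1]
      · rw [hs, Finset.card_pair hp.2.2]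
  have hdisj : ∀ {s t : Finset (Fin 6)}, s.card = 2 → t.card = 2 → s ≠ t →
      Disjoint s.offDiag t.offDiag := fun {s t} hs ht hst =>
    Finset.disjoint_left.2 fun p hp hp' => hst ((hpair hs p hp).symm.trans (hpair ht p hp'))
  have hcard : ∀ {s : Finset (Fin 6)}, s.card = 2 → s.offDiag.card = 2 := fun {s} hs => by
    rw [Finset.offDiag_card, hs]
  have hsub : edgePairs v ⊆ (Finset.univ : Finset (Fin 6)).offDiag \
      (e.offDiag ∪ f.offDiag ∪ g.offDiag) := fun p hp => by
    simp only [edgePairs, Finset.mem_filter, Finset.mem_univ, true_and] at hp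
    rw [Finset.mem_sdiff, Finset.mem_offDiag]
    refine ⟨⟨Finset.mem_univ _, Finset.mem_univ _, hp.1⟩, fun h => hp.2 ?_⟩
    rcases Finset.mem_union.1 h with h | h
    · rcases Finset.mem_union.1 h with h | h
      · rw [hpair he.1 p h]; exact he
      · rw [hpair hf.1 p h]; exact hf
    · rw [hpair hg.1 p h]; exact hg
  refine (Finset.card_le_card hsub).trans ?_
  rw [Finset.card_sdiff_of_subset, Finset.card_union_of_disjoint, Finset.card_union_of_disjoint,
    hcard he.1, hcard hf.1, hcard hg.1, Finset.offDiag_card]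
  · simp
  · exact hdisj he.1 hf.1 hef
  · rw [Finset.disjoint_union_left]
    exact ⟨hdisj he.1 hg.1 heg, hdisj hf.1 hg.1 hfg⟩
  · intro p hp
    simp only [Finset.mem_union, Finset.mem_offDiag] at hp
    rw [Finset.mem_offDiag]
    refine ⟨Finset.mem_univ _, Finset.mem_univ _, ?_⟩
    rcases hp with (h | h) | h <;> exact h.2.2

lemma edgeSlope_cos_sin (b : OrthonormalBasis (Fin 3) ℝ (EuclideanSpace ℝ (Fin 3)))
    (w : EuclideanSpace ℝ (Fin 3)) (β : ℝ) :
    edgeSlope b w (Real.cos β, Real.sin β) =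
      Real.cos β * (inner ℝ (b 1) w / (1 - inner ℝ (b 0) w)) +
        Real.sin β * (inner ℝ (b 2) w / (1 - inner ℝ (b 0) w)) := by
  simp only [edgeSlope]; ring

lemma integral_edgeSlope (b : OrthonormalBasis (Fin 3) ℝ (EuclideanSpace ℝ (Fin 3)))
    (w : EuclideanSpace ℝ (Fin 3)) :
    ∫ β in -Real.pi..Real.pi, cellWeight (cosOfCot (edgeSlope b w (Real.cos β, Real.sin β))) =
      edgeIntegral √((inner ℝ (b 1) w / (1 - inner ℝ (b 0) w)) ^ 2 +
        (inner ℝ (b 2) w / (1 - inner ℝ (b 0) w)) ^ 2) := by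
  simp_rw [edgeSlope_cos_sin]
  exact integral_cellWeight_eq _ _

lemma sum_sq_coord_eq_one (b : OrthonormalBasis (Fin 3) ℝ (EuclideanSpace ℝ (Fin 3)))
    {w : EuclideanSpace ℝ (Fin 3)} (hw : ‖w‖ = 1) :
    inner ℝ (b 0) w ^ 2 + inner ℝ (b 1) w ^ 2 + inner ℝ (b 2) w ^ 2 = 1 := by
  have := b.sum_sq_inner_right w
  rw [Fin.sum_univ_three, hw] at this
  linarith

lemma countable_edgeSlope_eq (b : OrthonormalBasis (Fin 3) ℝ (EuclideanSpace ℝ (Fin 3)))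
    {w z : EuclideanSpace ℝ (Fin 3)} (hw : ‖w‖ = 1) (hz : ‖z‖ = 1) (hwz : w ≠ z)
    (hw0 : inner ℝ (b 0) w < 1) (hz0 : inner ℝ (b 0) z < 1) :
    {β | edgeSlope b w (Real.cos β, Real.sin β) =
      edgeSlope b z (Real.cos β, Real.sin β)}.Countable := by
  set X := inner ℝ (b 1) w / (1 - inner ℝ (b 0) w) with hX
  set Y := inner ℝ (b 2) w / (1 - inner ℝ (b 0) w) with hY
  set X' := inner ℝ (b 1) z / (1 - inner ℝ (b 0) z) with hX'
  set Y' := inner ℝ (b 2) z / (1 - inner ℝ (b 0) z) with hY'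
  have key : X - X' ≠ 0 ∨ Y - Y' ≠ 0 := by
    by_contra! h
    have s1 : (0 : ℝ) < 1 - inner ℝ (b 0) w := by linarith
    have s2 : (0 : ℝ) < 1 - inner ℝ (b 0) z := by linarith
    have e1 : inner ℝ (b 1) w = X * (1 - inner ℝ (b 0) w) := (div_mul_cancel₀ _ s1.ne').symm
    have e2 : inner ℝ (b 2) w = Y * (1 - inner ℝ (b 0) w) := (div_mul_cancel₀ _ s1.ne').symm
    have e3 : inner ℝ (b 1) z = X * (1 - inner ℝ (b 0) z) := by
      rw [sub_eq_zero.1 h.1]; exact (div_mul_cancel₀ _ s2.ne').symm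
    have e4 : inner ℝ (b 2) z = Y * (1 - inner ℝ (b 0) z) := by
      rw [sub_eq_zero.1 h.2]; exact (div_mul_cancel₀ _ s2.ne').symm
    have n1 := sum_sq_coord_eq_one b hw
    have n2 := sum_sq_coord_eq_one b hz
    rw [e1, e2] at n1
    rw [e3, e4] at n2
    have m1 : (X ^ 2 + Y ^ 2) * (1 - inner ℝ (b 0) w) = 1 + inner ℝ (b 0) w :=
      mul_right_cancel₀ s1.ne' (by linear_combination n1)
    have m2 : (X ^ 2 + Y ^ 2) * (1 - inner ℝ (b 0) z) = 1 + inner ℝ (b 0) z :=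
      mul_right_cancel₀ s2.ne' (by linear_combination n2)
    have hpos : X ^ 2 + Y ^ 2 + 1 ≠ 0 := by positivity
    have e0 : inner ℝ (b 0) w = inner ℝ (b 0) z :=
      mul_left_cancel₀ hpos (by linear_combination m2 - m1)
    refine hwz (b.repr.injective ?_)
    ext k
    rw [b.repr_apply_apply, b.repr_apply_apply]
    fin_cases k
    · exact e0
    · exact e1.trans (e0 ▸ e3.symm)
    · exact e2.trans (e0 ▸ e4.symm)
  refine (countable_setOf_trig_eq_zero key).mono fun β hβ => ?_
  rw [Set.mem_ofPred_eq, edgeSlope_cos_sin, edgeSlope_cos_sin] at hβ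
  rw [Set.mem_ofPred_eq]
  linear_combination hβ

/-- The directions in which the bisector of `v i` and `v j` bounds the cell of `v i`. -/
def activeSet (b : OrthonormalBasis (Fin 3) ℝ (EuclideanSpace ℝ (Fin 3)))
    (v : Fin 6 → EuclideanSpace ℝ (Fin 3)) (i j : Fin 6) : Set ℝ :=
  {β | maxSlope b v i (Real.cos β, Real.sin β) = edgeSlope b (v j) (Real.cos β, Real.sin β)}

lemma countable_activeSet {b : OrthonormalBasis (Fin 3) ℝ (EuclideanSpace ℝ (Fin 3))}
    {v : Fin 6 → EuclideanSpace ℝ (Fin 3)} (hv : ∀ i, ‖v i‖ = 1)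
    (hinj : Function.Injective v) {i j : Fin 6} (hb : b 0 = v i) (hij : i ≠ j)
    (hp : {i, j} ∈ positivePairs (affineRelations v)) : (activeSet b v i j).Countable := by
  obtain ⟨-, l, hl, hpos⟩ := hp
  have hi : 0 < l i := mem_posSet.1 (hpos ▸ by simp)
  have hj : 0 < l j := mem_posSet.1 (hpos ▸ by simp)
  have hnp : ∀ k, k ≠ i → k ≠ j → l k ≤ 0 := fun k h1 h2 => by
    by_contra! h
    have := mem_posSet.2 h
    rw [hpos] at this
    simp [h1, h2] at this
  have hlt : ∀ k, k ≠ i → inner ℝ (b 0) (v k) < 1 := fun k hk => by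
    rw [hb]; exact inner_lt_one_of_injective hv hinj hk
  have hself : inner ℝ (b 0) (v i) = 1 := by
    rw [hb, real_inner_self_eq_norm_sq, hv]; norm_num
  obtain ⟨k, hki, hkj, hk⟩ : ∃ k, k ≠ i ∧ k ≠ j ∧ l k < 0 := by
    by_contra! h
    have h0 : 0 < ∑ k, l k := Finset.sum_pos' (fun k _ => by
      by_cases h1 : k = i
      · rw [h1]; exact hi.le
      by_cases h2 : k = j
      · rw [h2]; exact hj.le
      exact h k h1 h2) ⟨i, Finset.mem_univ i, hi⟩
    exact h0.ne' (mem_affineRelations.1 hl).2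
  refine (countable_edgeSlope_eq b (hv j) (hv k) (hinj.ne hkj.symm) (hlt j hij.symm)
    (hlt k hki)).mono fun β hβ => ?_
  set s : Fin 6 → ℝ := fun k => edgeSlope b (v k) (Real.cos β, Real.sin β) with hs
  have hmax : ∀ k, k ≠ i → s k ≤ s j := fun k hk => by
    rw [hs]; simp only
    rw [← show _ = _ from hβ]
    exact Finset.le_sup' (fun j => edgeSlope b (v j) (Real.cos β, Real.sin β))
      (by simp [hk] : k ∈ Finset.univ.erase i)
  have hsk : ∀ k, k ≠ i → (1 - inner ℝ (b 0) (v k)) * s k =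
      Real.cos β * inner ℝ (b 1) (v k) + Real.sin β * inner ℝ (b 2) (v k) := fun k hk =>
    mul_div_cancel₀ _ (sub_pos.2 (hlt k hk)).ne'
  have hterm : ∀ k, l k * (1 - inner ℝ (b 0) (v k)) * (s j - s k) =
      s j * (l k * (1 - inner ℝ (b 0) (v k))) - (Real.cos β * (l k * inner ℝ (b 1) (v k)) +
        Real.sin β * (l k * inner ℝ (b 2) (v k))) := fun k => by
    by_cases hk : k = i
    · subst hk
      have o1 : inner ℝ (b 1) (v k) = 0 := by rw [← hb]; exact b.orthonormal.2 (by simp)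
      have o2 : inner ℝ (b 2) (v k) = 0 := by rw [← hb]; exact b.orthonormal.2 (by simp)
      rw [hself, o1, o2]; ring
    · linear_combination (-l k) * hsk k hk
  have hsum : ∑ k, l k * (1 - inner ℝ (b 0) (v k)) * (s j - s k) = 0 := by
    simp_rw [hterm]
    rw [Finset.sum_sub_distrib, Finset.sum_add_distrib, ← Finset.mul_sum, ← Finset.mul_sum,
      ← Finset.mul_sum, (sum_mul_one_sub_inner hl _).1, (sum_mul_one_sub_inner hl _).2,
      (sum_mul_one_sub_inner hl _).2]
    ring
  have hle : ∀ k ∈ Finset.univ, l k * (1 - inner ℝ (b 0) (v k)) * (s j - s k) ≤ 0 :=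
    fun k _ => by
      by_cases h1 : k = i
      · rw [h1, hself]; simp
      by_cases h2 : k = j
      · rw [h2]; simp
      exact mul_nonpos_of_nonpos_of_nonneg (mul_nonpos_of_nonpos_of_nonneg (hnp k h1 h2)
        (sub_pos.2 (hlt k h1)).le) (sub_nonneg.2 (hmax k h1))
  have h0 := (Finset.sum_eq_zero_iff_of_nonpos hle).1 hsum k (Finset.mem_univ k)
  have h1 : l k * (1 - inner ℝ (b 0) (v k)) ≠ 0 :=
    mul_ne_zero hk.ne (sub_pos.2 (hlt k hki)).ne'
  exact sub_eq_zero.1 ((mul_eq_zero.1 h0).resolve_left h1)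

lemma continuous_cellWeight_edgeSlope
    (b : OrthonormalBasis (Fin 3) ℝ (EuclideanSpace ℝ (Fin 3)))
    (w : EuclideanSpace ℝ (Fin 3)) :
    Continuous fun β => cellWeight (cosOfCot (edgeSlope b w (Real.cos β, Real.sin β))) :=
  continuous_cellWeight.comp (continuous_cosOfCot.comp
    ((continuous_edgeSlope b w).comp (by fun_prop)))

lemma continuous_cosOfCot_maxSlope {ι : Type*} [Fintype ι] [DecidableEq ι] [Nontrivial ι]
    (b : OrthonormalBasis (Fin 3) ℝ (EuclideanSpace ℝ (Fin 3)))
    (v : ι → EuclideanSpace ℝ (Fin 3)) (i : ι) :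
    Continuous fun β => cosOfCot (maxSlope b v i (Real.cos β, Real.sin β)) :=
  continuous_cosOfCot.comp ((continuous_maxSlope b v i).comp (by fun_prop))

lemma integral_level_le_card {ι : Type*} [Fintype ι] [DecidableEq ι] [Nontrivial ι]
    (b : OrthonormalBasis (Fin 3) ℝ (EuclideanSpace ℝ (Fin 3)))
    (v : ι → EuclideanSpace ℝ (Fin 3)) (i : ι) (N : Finset (ι × ι))
    (hN : ∀ᵐ β : ℝ, ∃ p ∈ N, maxSlope b v i (Real.cos β, Real.sin β) =
      edgeSlope b (v p.2) (Real.cos β, Real.sin β)) :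
    ∫ β in -Real.pi..Real.pi,
      (cosOfCot (maxSlope b v i (Real.cos β, Real.sin β)) - lowLevel) *
        (highLevel - cosOfCot (maxSlope b v i (Real.cos β, Real.sin β))) ≤
      N.card * edgeIntegral 1 := by
  have hx := continuous_cosOfCot_maxSlope b v i
  have hπ : -Real.pi ≤ Real.pi := by linarith [Real.pi_pos]
  have h1 : ∫ β in -Real.pi..Real.pi,
      (cosOfCot (maxSlope b v i (Real.cos β, Real.sin β)) - lowLevel) *
        (highLevel - cosOfCot (maxSlope b v i (Real.cos β, Real.sin β))) ≤
      ∫ β in -Real.pi..Real.pi, ∑ p ∈ N,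
        cellWeight (cosOfCot (edgeSlope b (v p.2) (Real.cos β, Real.sin β))) := by
    refine intervalIntegral.integral_mono_ae hπ
      (Continuous.intervalIntegrable (by fun_prop) _ _)
      (Continuous.intervalIntegrable (continuous_finsetSum _ fun p _ =>
        continuous_cellWeight_edgeSlope b (v p.2)) _ _) ?_
    filter_upwards [hN] with β ⟨p, hp, hact⟩
    rw [hact]
    exact (le_max_right _ _).trans (Finset.single_le_sum
      (f := fun p : ι × ι =>
        cellWeight (cosOfCot (edgeSlope b (v p.2) (Real.cos β, Real.sin β))))
      (fun p _ => cellWeight_nonneg _) hp)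
  refine h1.trans ?_
  rw [intervalIntegral.integral_finsetSum fun p _ =>
    (continuous_cellWeight_edgeSlope b (v p.2)).intervalIntegrable _ _, ← nsmul_eq_mul,
    ← Finset.sum_const]
  refine Finset.sum_le_sum fun p _ => ?_
  rw [integral_edgeSlope]
  exact edgeIntegral_le (Real.sqrt_nonneg _)

lemma integral_level_le {b : OrthonormalBasis (Fin 3) ℝ (EuclideanSpace ℝ (Fin 3))}
    {v : Fin 6 → EuclideanSpace ℝ (Fin 3)} (hv : ∀ i, ‖v i‖ = 1)
    (hinj : Function.Injective v) {i : Fin 6} (hb : b 0 = v i) :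
    ∫ β in -Real.pi..Real.pi,
      (cosOfCot (maxSlope b v i (Real.cos β, Real.sin β)) - lowLevel) *
        (highLevel - cosOfCot (maxSlope b v i (Real.cos β, Real.sin β))) ≤
      ((edgePairs v).filter fun p => p.1 = i).card * edgeIntegral 1 := by
  have hae : ∀ᵐ β : ℝ, ∀ j, i ≠ j → {i, j} ∈ positivePairs (affineRelations v) →
      β ∉ activeSet b v i j := by
    refine ae_all_iff.2 fun j => ?_
    by_cases h : i ≠ j ∧ {i, j} ∈ positivePairs (affineRelations v)
    · filter_upwards [(countable_activeSet hv hinj hb h.1 h.2).ae_notMem volume] with β hβ _ _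
      exact hβ
    · exact ae_of_all _ fun β h1 h2 => (h ⟨h1, h2⟩).elim
  refine integral_level_le_card b v i _ ?_
  filter_upwards [hae] with β hβ
  obtain ⟨j, hj, hmax⟩ := Finset.exists_mem_eq_sup' (erase_nonempty i)
    fun j => edgeSlope b (v j) (Real.cos β, Real.sin β)
  have hij : i ≠ j := (Finset.ne_of_mem_erase hj).symm
  refine ⟨(i, j), ?_, hmax⟩
  simp only [edgePairs, Finset.mem_filter, Finset.mem_univ, true_and, and_true]
  exact ⟨hij, fun h => hβ j hij h hmax⟩

lemma edgeIntegral_nonneg (k : ℝ) : 0 ≤ edgeIntegral k :=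
  intervalIntegral.integral_nonneg (by linarith [Real.pi_pos]) fun _ _ => cellWeight_nonneg _

/-- The mean width shared by all regular octahedra inscribed in the unit sphere. -/
def octahedronWidth : ℝ :=
  (√(2 * Real.pi))⁻¹ ^ 3 * (24 * edgeIntegral 1 +
    6 * (2 * Real.pi * ((1 - lowLevel) * (1 - highLevel)))) - levelShift

lemma integral_level_add {ι : Type*} [Fintype ι] [DecidableEq ι] [Nontrivial ι]
    (b : OrthonormalBasis (Fin 3) ℝ (EuclideanSpace ℝ (Fin 3)))
    (v : ι → EuclideanSpace ℝ (Fin 3)) (i : ι) (c : ℝ) :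
    ∫ β in -Real.pi..Real.pi,
      ((cosOfCot (maxSlope b v i (Real.cos β, Real.sin β)) - lowLevel) *
        (highLevel - cosOfCot (maxSlope b v i (Real.cos β, Real.sin β))) + c) =
    (∫ β in -Real.pi..Real.pi,
      (cosOfCot (maxSlope b v i (Real.cos β, Real.sin β)) - lowLevel) *
        (highLevel - cosOfCot (maxSlope b v i (Real.cos β, Real.sin β)))) +
      2 * Real.pi * c := by
  have hx := continuous_cosOfCot_maxSlope b v i
  rw [intervalIntegral.integral_add (Continuous.intervalIntegrable (by fun_prop) _ _)
    (by simp), intervalIntegral.integral_const, smul_eq_mul]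
  ring

lemma meanWidth_le_of_injective {v : Fin 6 → EuclideanSpace ℝ (Fin 3)} (hv : ∀ i, ‖v i‖ = 1)
    (hinj : Function.Injective v) : meanWidth v ≤ octahedronWidth := by
  choose b hb using fun i => exists_orthonormalBasis_of_norm_eq_one (hv i)
  rw [octahedronWidth, le_sub_iff_add_le, meanWidth_add_levelShift hinj]
  have hc : (0 : ℝ) ≤ (√(2 * Real.pi))⁻¹ ^ 3 := by positivity
  calc _ ≤ ∑ i, (√(2 * Real.pi))⁻¹ ^ 3 *
        (((edgePairs v).filter fun p => p.1 = i).card * edgeIntegral 1 +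
          2 * Real.pi * ((1 - lowLevel) * (1 - highLevel))) := by
        refine Finset.sum_le_sum fun i _ => ?_
        rw [integral_strictCell (hb i) fun j hj => inner_lt_one_of_injective hv hinj hj,
          integral_level_add]
        exact mul_le_mul_of_nonneg_left
          (add_le_add_left (integral_level_le hv hinj (hb i)) _) hc
    _ = (√(2 * Real.pi))⁻¹ ^ 3 * ((edgePairs v).card * edgeIntegral 1 +
          6 * (2 * Real.pi * ((1 - lowLevel) * (1 - highLevel)))) := by
        rw [← Finset.mul_sum, Finset.sum_add_distrib, ← Finset.sum_mul,
          Finset.card_eq_sum_card_fiberwise (f := Prod.fst) (s := edgePairs v)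
            (t := Finset.univ) (fun _ _ => Finset.mem_coe.2 (Finset.mem_univ _))]
        simp
    _ ≤ _ := by
        refine mul_le_mul_of_nonneg_left (add_le_add_left
          (mul_le_mul_of_nonneg_right ?_ (edgeIntegral_nonneg 1)) _) hc
        exact_mod_cast card_edgePairs_le hv hinj

lemma cosOfCot_le_lowLevel_iff {t : ℝ} : cosOfCot t ≤ lowLevel ↔ t ≤ 1 / √2 := by
  rw [lowLevel, cosOfCot_le_iff (by linarith [lowAngle_pos, Real.pi_pos])
    (by linarith [lowAngle_lt, Real.pi_pos]), tan_lowAngle]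

lemma cosOfCot_le_highLevel {t : ℝ} (h : t ≤ 1) : cosOfCot t ≤ highLevel := by
  have h1 : cosOfCot t ≤ Real.sin (Real.pi / 4) :=
    (cosOfCot_le_iff (by linarith [Real.pi_pos]) (by linarith [Real.pi_pos])).2
      (by rwa [Real.tan_pi_div_four])
  rw [Real.sin_pi_div_four] at h1
  have h2 : √2 / 2 = 1 / √2 := by
    rw [div_eq_div_iff (by norm_num) (by positivity), Real.mul_self_sqrt (by norm_num)]; norm_num
  rw [h2] at h1
  exact h1.trans inv_sqrt_two_lt_highLevel.le

lemma sum_cellWeight_le_level {x y : ℝ} (h : x ^ 2 + y ^ 2 = 1) :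
    cellWeight (cosOfCot x) + cellWeight (cosOfCot (-x)) + cellWeight (cosOfCot y) +
      cellWeight (cosOfCot (-y)) ≤
    (cosOfCot (max |x| |y|) - lowLevel) * (highLevel - cosOfCot (max |x| |y|)) := by
  have hs : (0 : ℝ) < 1 / √2 := by positivity
  have hs2 : (1 / √2) ^ 2 = (1 / 2 : ℝ) := by
    rw [div_pow, Real.sq_sqrt (by norm_num)]; norm_num
  set t := 1 / √2 with ht
  have hz : ∀ {s : ℝ}, s ≤ t → cellWeight (cosOfCot s) = 0 := fun hs =>
    cellWeight_of_le (cosOfCot_le_lowLevel_iff.2 hs)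
  have hx1 : |x| ≤ 1 := abs_le_one_iff_mul_self_le_one.2 (by nlinarith [sq_nonneg y])
  have hy1 : |y| ≤ 1 := abs_le_one_iff_mul_self_le_one.2 (by nlinarith [sq_nonneg x])
  have hM : t ≤ max |x| |y| := by
    by_contra! hlt
    obtain ⟨h1, h2⟩ := max_lt_iff.1 hlt
    have := sq_abs x
    have := sq_abs y
    nlinarith [abs_nonneg x, abs_nonneg y]
  have hval : ∀ {s : ℝ}, t ≤ s → s ≤ 1 →
      cellWeight (cosOfCot s) = (cosOfCot s - lowLevel) * (highLevel - cosOfCot s) :=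
    fun h1 h2 => by
      refine cellWeight_of_mem ?_ (cosOfCot_le_highLevel h2)
      rcases h1.eq_or_lt with h | h
      · rw [← h, cosOfCot_eq, lowLevel_eq, hs2]
        refine le_of_eq ?_
        rw [ht, show (1 : ℝ) + 1 / 2 = 3 / 2 by norm_num, Real.sqrt_div (by norm_num)]
        field_simp
      · exact (lt_of_not_ge fun h' => (cosOfCot_le_lowLevel_iff.1 h').not_gt h).le
  rw [← hval hM (max_le hx1 hy1)]
  have hsmall : ∀ {a b : ℝ}, a ^ 2 + b ^ 2 = 1 → t ≤ a → |b| ≤ t := fun hab ha =>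
    abs_le_of_sq_le_sq (by nlinarith) hs.le
  by_cases c1 : t < x
  · have hb := hsmall h c1.le
    rw [max_eq_left ((hb.trans c1.le).trans (le_abs_self x)), abs_of_pos (hs.trans c1),
      hz (by linarith : -x ≤ t), hz ((le_abs_self y).trans hb), hz ((neg_le_abs y).trans hb)]
    linarith
  by_cases c2 : t < -x
  · have hb := hsmall (by simpa using h) c2.le
    rw [max_eq_left ((hb.trans c2.le).trans (neg_le_abs x)), abs_of_neg (by linarith),
      hz (by linarith : x ≤ t), hz ((le_abs_self y).trans hb), hz ((neg_le_abs y).trans hb)]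
    linarith
  by_cases c3 : t < y
  · have hb := hsmall (by linarith : y ^ 2 + x ^ 2 = 1) c3.le
    rw [max_eq_right ((hb.trans c3.le).trans (le_abs_self y)), abs_of_pos (hs.trans c3),
      hz (by linarith : -y ≤ t), hz ((le_abs_self x).trans hb), hz ((neg_le_abs x).trans hb)]
    linarith
  by_cases c4 : t < -y
  · have hb := hsmall (by linarith [neg_sq y] : (-y) ^ 2 + x ^ 2 = 1) c4.le
    rw [max_eq_right ((hb.trans c4.le).trans (neg_le_abs y)), abs_of_neg (by linarith),
      hz (by linarith : y ≤ t), hz ((le_abs_self x).trans hb), hz ((neg_le_abs x).trans hb)]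
    linarith
  rw [hz (not_lt.1 c1), hz (not_lt.1 c2), hz (not_lt.1 c3), hz (not_lt.1 c4)]
  simpa using cellWeight_nonneg _

/-- The vectors `v (a, s)` are the six vertices of a regular octahedron: three pairwise
orthogonal pairs of antipodal unit vectors. -/
structure IsOctahedron (v : Fin 3 × Fin 2 → EuclideanSpace ℝ (Fin 3)) : Prop where
  norm_eq_one : ∀ p, ‖v p‖ = 1
  antipodal : ∀ a, v (a, 1) = -v (a, 0)
  orthogonal : ∀ a c s t, a ≠ c → inner ℝ (v (a, s)) (v (c, t)) = 0

namespace IsOctahedron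

variable {v : Fin 3 × Fin 2 → EuclideanSpace ℝ (Fin 3)}

lemma inner_lt_one (hv : IsOctahedron v) {p q : Fin 3 × Fin 2} (h : q ≠ p) :
    inner ℝ (v p) (v q) < 1 := by
  obtain ⟨a, s⟩ := p
  obtain ⟨c, t⟩ := q
  by_cases hac : a = c
  · subst hac
    have hst : t ≠ s := fun h' => h (by rw [h'])
    have hself : inner ℝ (v (a, 0)) (v (a, 0)) = (1 : ℝ) := by
      rw [real_inner_self_eq_norm_sq, hv.norm_eq_one]; norm_num
    fin_cases s <;> fin_cases t
    · exact (hst rfl).elim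
    · simp [hv.antipodal, hv.norm_eq_one]
    · simp [hv.antipodal, hv.norm_eq_one]
    · exact (hst rfl).elim
  · rw [hv.orthogonal a c s t hac]; norm_num

lemma injective (hv : IsOctahedron v) : Function.Injective v := fun p q h => by
  by_contra hne
  have h1 := hv.inner_lt_one (Ne.symm hne)
  rw [← h, real_inner_self_eq_norm_sq, hv.norm_eq_one] at h1
  norm_num at h1

lemma exists_frame (hv : IsOctahedron v) (a : Fin 3) (s : Fin 2) :
    ∃ b : OrthonormalBasis (Fin 3) ℝ (EuclideanSpace ℝ (Fin 3)),
      b 0 = v (a, s) ∧ b 1 = v (a + 1, 0) ∧ b 2 = v (a + 2, 0) := by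
  have ho : Orthonormal ℝ fun k : Fin 3 => v (a + k, if k = 0 then s else 0) :=
    ⟨fun k => hv.norm_eq_one _, fun i j hij =>
      hv.orthogonal _ _ _ _ fun h => hij (add_left_cancel h)⟩
  obtain ⟨b, hb⟩ := Orthonormal.exists_orthonormalBasis_extension_of_card_eq
    (𝕜 := ℝ) (E := EuclideanSpace ℝ (Fin 3)) (ι := Fin 3) (by simp)
    (v := fun k : Fin 3 => v (a + k, if k = 0 then s else 0)) (s := Set.univ)
    (ho.comp _ Subtype.val_injective)
  refine ⟨b, ?_, ?_, ?_⟩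
  · simpa using hb 0 (Set.mem_univ _)
  · simpa using hb 1 (Set.mem_univ _)
  · simpa using hb 2 (Set.mem_univ _)

lemma maxSlope_eq (hv : IsOctahedron v)
    {b : OrthonormalBasis (Fin 3) ℝ (EuclideanSpace ℝ (Fin 3))} {a : Fin 3} {s : Fin 2}
    (h1 : b 1 = v (a + 1, 0)) (h2 : b 2 = v (a + 2, 0))
    (x y : ℝ) : maxSlope b v (a, s) (x, y) = max |x| |y| := by
  have o12 : inner ℝ (b 1) (b 2) = 0 := b.orthonormal.2 (by decide)
  have o21 : inner ℝ (b 2) (b 1) = 0 := b.orthonormal.2 (by decide)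
  have o01 : inner ℝ (b 0) (b 1) = 0 := b.orthonormal.2 (by decide)
  have o02 : inner ℝ (b 0) (b 2) = 0 := b.orthonormal.2 (by decide)
  have o10 : inner ℝ (b 1) (b 0) = 0 := b.orthonormal.2 (by decide)
  have o20 : inner ℝ (b 2) (b 0) = 0 := b.orthonormal.2 (by decide)
  have e1 : edgeSlope b (v (a + 1, 0)) (x, y) = x := by
    rw [← h1]; simp [edgeSlope, o21, o01]
  have e1' : edgeSlope b (v (a + 1, 1)) (x, y) = -x := by
    rw [hv.antipodal, ← h1]; simp [edgeSlope, o21, o01]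
  have e2 : edgeSlope b (v (a + 2, 0)) (x, y) = y := by
    rw [← h2]; simp [edgeSlope, o12, o02]
  have e2' : edgeSlope b (v (a + 2, 1)) (x, y) = -y := by
    rw [hv.antipodal, ← h2]; simp [edgeSlope, o12, o02]
  have e0 : ∀ t, edgeSlope b (v (a, t)) (x, y) = 0 := fun t => by
    have z1 : inner ℝ (b 1) (v (a, t)) = 0 := by
      rw [h1]; exact hv.orthogonal _ _ _ _ (by simp)
    have z2 : inner ℝ (b 2) (v (a, t)) = 0 := by
      rw [h2]; exact hv.orthogonal _ _ _ _ (by simp)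
    simp [edgeSlope, z1, z2]
  have hle : ∀ c t, c ≠ a → edgeSlope b (v (c, t)) (x, y) ≤ maxSlope b v (a, s) (x, y) :=
    fun c t hc => Finset.le_sup' (fun j => edgeSlope b (v j) (x, y)) (by simp [hc])
  refine le_antisymm (Finset.sup'_le _ _ ?_) (max_le (abs_le'.2 ⟨?_, ?_⟩) (abs_le'.2 ⟨?_, ?_⟩))
  · rintro ⟨c, t⟩ -
    obtain ⟨k, rfl⟩ : ∃ k, c = a + k := ⟨c - a, by abel⟩
    fin_cases k <;> fin_cases t <;> simp only [Fin.zero_eta, Fin.mk_one, Fin.reduceFinMk,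
      Fin.isValue, add_zero, e0, e1, e1', e2, e2', le_max_iff]
    · exact Or.inl (abs_nonneg x)
    · exact Or.inl (abs_nonneg x)
    · exact Or.inl (le_abs_self x)
    · exact Or.inl (neg_le_abs x)
    · exact Or.inr (le_abs_self y)
    · exact Or.inr (neg_le_abs y)
  · exact e1.symm.trans_le (hle (a + 1) 0 (by simp))
  · exact e1'.symm.trans_le (hle (a + 1) 1 (by simp))
  · exact e2.symm.trans_le (hle (a + 2) 0 (by simp))
  · exact e2'.symm.trans_le (hle (a + 2) 1 (by simp))

lemma octahedronWidth_le (hv : IsOctahedron v) : octahedronWidth ≤ meanWidth v := by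
  rw [octahedronWidth, sub_le_iff_le_add, meanWidth_add_levelShift hv.injective]
  have hc : (0 : ℝ) ≤ (√(2 * Real.pi))⁻¹ ^ 3 := by positivity
  have hcell : ∀ p : Fin 3 × Fin 2, (√(2 * Real.pi))⁻¹ ^ 3 * (4 * edgeIntegral 1 +
      2 * Real.pi * ((1 - lowLevel) * (1 - highLevel))) ≤
      ∫ u, (strictCell v p).indicator (fun u => inner ℝ (v p) u + levelShift) u
        ∂(stdGaussian (EuclideanSpace ℝ (Fin 3))) := by
    rintro ⟨a, s⟩
    obtain ⟨b, h0, h1, h2⟩ := hv.exists_frame a s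
    rw [integral_strictCell h0 fun q hq => hv.inner_lt_one hq, integral_level_add]
    refine mul_le_mul_of_nonneg_left (add_le_add_left ?_ _) hc
    have hcont : ∀ x y : ℝ, Continuous fun β =>
        cellWeight (cosOfCot (Real.cos β * x + Real.sin β * y)) := fun x y =>
      continuous_cellWeight.comp (continuous_cosOfCot.comp (by fun_prop))
    have hI : ∀ x y : ℝ, IntervalIntegrable (fun β =>
        cellWeight (cosOfCot (Real.cos β * x + Real.sin β * y))) volume (-Real.pi) Real.pi :=
      fun x y => (hcont x y).intervalIntegrable _ _
    have hx := continuous_cosOfCot_maxSlope b v (a, s)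
    calc 4 * edgeIntegral 1 = ∫ β in -Real.pi..Real.pi,
          (cellWeight (cosOfCot (Real.cos β * 1 + Real.sin β * 0)) +
            cellWeight (cosOfCot (Real.cos β * (-1) + Real.sin β * 0)) +
            cellWeight (cosOfCot (Real.cos β * 0 + Real.sin β * 1)) +
            cellWeight (cosOfCot (Real.cos β * 0 + Real.sin β * (-1)))) := by
          rw [intervalIntegral.integral_add (((hI _ _).add (hI _ _)).add (hI _ _)) (hI _ _),
            intervalIntegral.integral_add ((hI _ _).add (hI _ _)) (hI _ _),
            intervalIntegral.integral_add (hI _ _) (hI _ _)]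
          simp only [integral_cellWeight_eq]
          norm_num
          ring
      _ ≤ _ := by
          refine intervalIntegral.integral_mono_on (by linarith [Real.pi_pos])
            ((((hI _ _).add (hI _ _)).add (hI _ _)).add (hI _ _))
            (Continuous.intervalIntegrable (by fun_prop) _ _) fun β _ => ?_
          rw [hv.maxSlope_eq h1 h2]
          have := sum_cellWeight_le_level (Real.cos_sq_add_sin_sq β)
          simpa using this
  refine le_trans (le_of_eq ?_) (Finset.sum_le_sum fun p _ => hcell p)
  simp only [Finset.sum_const, Finset.card_univ, Fintype.card_prod, Fintype.card_fin, nsmul_eq_mul]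
  push_cast
  ring

lemma neg (hv : IsOctahedron v) : IsOctahedron (-v) :=
  ⟨fun p => by simp [hv.norm_eq_one], fun a => by simp [hv.antipodal],
    fun a c s t hac => by simp [hv.orthogonal a c s t hac]⟩

end IsOctahedron

lemma re_trace_mul_eq {A B : Matrix (Fin 2) (Fin 2) ℂ} (hA : A.IsHermitian) (hA0 : A.trace = 0)
    (hB : B.IsHermitian) (hB0 : B.trace = 0) :
    (A * B).trace.re =
      2 * ((A 0 0).re * (B 0 0).re + (A 0 1).re * (B 0 1).re + (A 0 1).im * (B 0 1).im) := by
  have hdiag : ∀ {C : Matrix (Fin 2) (Fin 2) ℂ}, C.IsHermitian → C.trace = 0 →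
      (C 0 0).im = 0 ∧ C 1 1 = -C 0 0 ∧ C 1 0 = star (C 0 1) := fun {C} hC hC0 => by
    refine ⟨Complex.conj_eq_iff_im.1 (hC.apply 0 0), ?_, (hC.apply 1 0).symm⟩
    rw [Matrix.trace_fin_two] at hC0
    linear_combination hC0
  obtain ⟨a1, a2, a3⟩ := hdiag hA hA0
  obtain ⟨b1, b2, b3⟩ := hdiag hB hB0
  simp [Matrix.trace_fin_two, Matrix.mul_apply, Fin.sum_univ_two, a1, a2, a3, b1, b2, b3]
  ring

/-- Parseval's identity in the space of traceless Hermitian `2 × 2` matrices. -/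
lemma sum_re_trace_mul_re_trace {E : Fin 3 → Matrix (Fin 2) (Fin 2) ℂ}
    (hE : ∀ k, (E k).IsHermitian) (hE0 : ∀ k, (E k).trace = 0)
    (hort : ∀ k l, (E k * E l).trace = if k = l then (1 : ℂ) else 0)
    {A B : Matrix (Fin 2) (Fin 2) ℂ} (hA : A.IsHermitian) (hA0 : A.trace = 0)
    (hB : B.IsHermitian) (hB0 : B.trace = 0) :
    ∑ k, (E k * A).trace.re * (E k * B).trace.re = (A * B).trace.re := by
  let M : Matrix (Fin 3) (Fin 3) ℝ := Matrix.of fun k =>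
    ![(E k 0 0).re, (E k 0 1).re, (E k 0 1).im]
  have hM : ((2 : ℝ) • M) * Mᵀ = 1 := by
    ext k l
    have h := congrArg Complex.re (hort k l)
    rw [re_trace_mul_eq (hE k) (hE0 k) (hE l) (hE0 l)] at h
    simp only [Matrix.one_apply]
    rw [← show (if k = l then (1 : ℂ) else 0).re = if k = l then (1 : ℝ) else 0 by
      split_ifs <;> simp, ← h]
    simp [M, Matrix.mul_apply, Fin.sum_univ_three]
    ring
  have hM' : Mᵀ * ((2 : ℝ) • M) = 1 := mul_eq_one_comm.1 hM
  have key : ∀ i j, ∑ k, M k i * (2 * M k j) = if i = j then 1 else 0 := fun i j => by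
    have := congrFun (congrFun hM' i) j
    rw [Matrix.mul_apply] at this
    simpa [Matrix.one_apply] using this
  have h00 := key 0 0
  have h01 := key 0 1
  have h02 := key 0 2
  have h11 := key 1 1
  have h12 := key 1 2
  have h22 := key 2 2
  simp [M, Fin.sum_univ_three] at h00 h01 h02 h11 h12 h22
  simp only [fun k => re_trace_mul_eq (hE k) (hE0 k) hA hA0,
    fun k => re_trace_mul_eq (hE k) (hE0 k) hB hB0, re_trace_mul_eq hA hA0 hB hB0,
    Fin.sum_univ_three]
  linear_combination 2 * (A 0 0).re * (B 0 0).re * h00 + 2 * (A 0 1).re * (B 0 1).re * h11 +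
    2 * (A 0 1).im * (B 0 1).im * h22 +
    2 * ((A 0 0).re * (B 0 1).re + (A 0 1).re * (B 0 0).re) * h01 +
    2 * ((A 0 0).re * (B 0 1).im + (A 0 1).im * (B 0 0).re) * h02 +
    2 * ((A 0 1).re * (B 0 1).im + (A 0 1).im * (B 0 1).re) * h12

lemma isHermitian_Qmat (ψ : Fin 2 → ℂ) : (Qmat ψ).IsHermitian := by
  ext i j
  fin_cases i <;> fin_cases j <;> simp [Qmat, Matrix.vecMulVec_apply, mul_comm]

lemma trace_Qmat {ψ : Fin 2 → ℂ} (h : star ψ ⬝ᵥ ψ = 1) : (Qmat ψ).trace = 0 := by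
  simp only [dotProduct, Fin.sum_univ_two, Pi.star_apply] at h
  simp [Qmat]
  simp at h
  linear_combination h

lemma re_trace_Qmat_mul_Qmat {ψ φ : Fin 2 → ℂ} (hψ : star ψ ⬝ᵥ ψ = 1) (hφ : star φ ⬝ᵥ φ = 1) :
    (Qmat ψ * Qmat φ).trace.re = Complex.normSq (star ψ ⬝ᵥ φ) - 1 / 2 := by
  have h : (Qmat ψ * Qmat φ).trace =
      (star ψ ⬝ᵥ φ) * star (star ψ ⬝ᵥ φ) - (1 / 2 : ℂ) := by
    simp only [dotProduct, Fin.sum_univ_two, Pi.star_apply] at hψ hφ ⊢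
    simp [Qmat, Matrix.trace_fin_two, Matrix.mul_apply, Matrix.vecMulVec_apply,
      Fin.sum_univ_two]
    simp at hψ hφ
    linear_combination (-1 / 2 : ℂ) * hψ + (-1 / 2 : ℂ) * hφ
  rw [h, Complex.star_def, Complex.mul_conj]
  simp

/-- The Bloch vector of `ψ` in the coordinates given by the traceless matrices `E k`,
normalised to be a unit vector whenever `ψ` is one. -/
def blochVector (E : Fin 3 → Matrix (Fin 2) (Fin 2) ℂ) (ψ : Fin 2 → ℂ) :
    EuclideanSpace ℝ (Fin 3) :=
  WithLp.toLp 2 fun k => √2 * (E k * Qmat ψ).trace.re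

section Bloch

variable {E : Fin 3 → Matrix (Fin 2) (Fin 2) ℂ}

lemma inner_blochVector (hE : ∀ k, (E k).IsHermitian) (hE0 : ∀ k, (E k).trace = 0)
    (hort : ∀ k l, (E k * E l).trace = if k = l then (1 : ℂ) else 0) {ψ φ : Fin 2 → ℂ}
    (hψ : star ψ ⬝ᵥ ψ = 1) (hφ : star φ ⬝ᵥ φ = 1) :
    inner ℝ (blochVector E ψ) (blochVector E φ) = 2 * Complex.normSq (star ψ ⬝ᵥ φ) - 1 := by
  have h := sum_re_trace_mul_re_trace hE hE0 hort (isHermitian_Qmat ψ) (trace_Qmat hψ)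
    (isHermitian_Qmat φ) (trace_Qmat hφ)
  rw [re_trace_Qmat_mul_Qmat hψ hφ, Fin.sum_univ_three] at h
  have h2 : √2 * √2 = (2 : ℝ) := Real.mul_self_sqrt (by norm_num)
  simp only [blochVector, PiLp.inner_apply, Fin.sum_univ_three, RCLike.inner_apply, conj_trivial]
  linear_combination √2 * √2 * h + (Complex.normSq (star ψ ⬝ᵥ φ) - 1 / 2) * h2

lemma norm_blochVector (hE : ∀ k, (E k).IsHermitian) (hE0 : ∀ k, (E k).trace = 0)
    (hort : ∀ k l, (E k * E l).trace = if k = l then (1 : ℂ) else 0) {ψ : Fin 2 → ℂ}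
    (hψ : star ψ ⬝ᵥ ψ = 1) : ‖blochVector E ψ‖ = 1 := by
  have h := inner_blochVector hE hE0 hort hψ hψ
  rw [real_inner_self_eq_norm_sq, hψ, map_one] at h
  nlinarith [norm_nonneg (blochVector E ψ)]

lemma isOctahedron_blochVector (hE : ∀ k, (E k).IsHermitian) (hE0 : ∀ k, (E k).trace = 0)
    (hort : ∀ k l, (E k * E l).trace = if k = l then (1 : ℂ) else 0)
    {B : Fin (2 + 1) → Fin 2 → Fin 2 → ℂ} (hB : IsCompleteMUB B) :
    IsOctahedron fun p => blochVector E (B p.1 p.2) := by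
  have hunit : ∀ a s, star (B a s) ⬝ᵥ B a s = 1 := fun a s => by simpa using hB.1 a s s
  refine ⟨fun p => norm_blochVector hE hE0 hort (hunit _ _), fun a => ?_, fun a c s t hac => ?_⟩
  · have h := inner_blochVector hE hE0 hort (hunit a 1) (hunit a 0)
    rw [hB.1 a 1 0] at h
    have h' := norm_add_sq_real (blochVector E (B a 1)) (blochVector E (B a 0))
    rw [h, norm_blochVector hE hE0 hort (hunit a 1), norm_blochVector hE hE0 hort (hunit a 0)]
      at h'
    norm_num at h'
    exact eq_neg_of_add_eq_zero_left h'
  · rw [inner_blochVector hE hE0 hort (hunit a s) (hunit c t), hB.2 a c s t hac]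
    norm_num

lemma re_trace_mul_Qmat (g : Fin 3 → ℝ) (ψ : Fin 2 → ℂ) :
    ((∑ k, (g k : ℂ) • E k) * Qmat ψ).trace.re =
      (√2)⁻¹ * inner ℝ (blochVector E ψ) (WithLp.toLp 2 g) := by
  have h2 : √2 ≠ 0 := by positivity
  simp only [Finset.sum_mul, Matrix.trace_sum, Matrix.smul_mul, Matrix.trace_smul, Complex.re_sum,
    blochVector, PiLp.inner_apply, RCLike.inner_apply, conj_trivial, Finset.mul_sum, smul_eq_mul,
    Complex.re_ofReal_mul]
  refine Finset.sum_congr rfl fun k _ => ?_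
  field_simp

end Bloch

section Width

variable {ι : Type*} [Finite ι]

lemma integrable_iSup_inner [Nonempty ι] (v : ι → EuclideanSpace ℝ (Fin 3)) :
    Integrable (fun u => ⨆ i, inner ℝ (v i) u) (stdGaussian (EuclideanSpace ℝ (Fin 3))) := by
  have := Fintype.ofFinite ι
  refine (integrable_finsetSum Finset.univ fun i _ =>
    (integrable_inner_stdGaussian (v i)).norm).mono'
    (Measurable.iSup fun i => by fun_prop).aestronglyMeasurable (ae_of_all _ fun u => ?_)
  obtain ⟨i, hi⟩ := exists_eq_ciSup_of_finite (f := fun i => inner ℝ (v i) u)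
  rw [← hi]
  exact Finset.single_le_sum (f := fun i => ‖(inner ℝ (v i) u : ℝ)‖) (fun _ _ => norm_nonneg _)
    (Finset.mem_univ i)

lemma meanWidth_mono [Nonempty ι] {κ : Type*} [Finite κ] [Nonempty κ]
    {v : ι → EuclideanSpace ℝ (Fin 3)} {w : κ → EuclideanSpace ℝ (Fin 3)}
    (h : Set.range v ⊆ Set.range w) : meanWidth v ≤ meanWidth w := by
  refine integral_mono (integrable_iSup_inner v) (integrable_iSup_inner w) fun u =>
    ciSup_le fun i => ?_
  obtain ⟨j, hj⟩ := h ⟨i, rfl⟩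
  rw [← hj]
  exact le_ciSup (f := fun j => inner ℝ (w j) u) (Set.finite_range _).bddAbove j

lemma meanWidth_le {v : Fin 6 → EuclideanSpace ℝ (Fin 3)} (hv : ∀ i, ‖v i‖ = 1) :
    meanWidth v ≤ octahedronWidth := by
  have hinf : (Metric.sphere (0 : EuclideanSpace ℝ (Fin 3)) 1).Infinite := by
    refine (isPreconnected_sphere (Module.one_lt_rank_of_one_lt_finrank (by simp)) 0
      1).infinite_of_nontrivial ⟨EuclideanSpace.single 0 1, by simp, EuclideanSpace.single 1 1,
        by simp, fun h => ?_⟩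
    simpa using congrFun (congrArg WithLp.ofLp h) 0
  obtain ⟨s, hs, hs1, hcard⟩ := hinf.exists_superset_ncard_eq
    (s := Set.range v) (k := 6) (by rintro _ ⟨i, rfl⟩; simp [hv]) (Set.finite_range v)
    (by simpa [← Nat.card_coe_set_eq] using Finite.card_range_le v)
  have hfin : Finite s := Set.finite_of_ncard_ne_zero (by omega)
  let e : Fin 6 ≃ s := (Finite.equivFinOfCardEq (by rwa [Nat.card_coe_set_eq])).symm
  refine (meanWidth_mono (w := fun i => (e i : EuclideanSpace ℝ (Fin 3))) ?_).trans
    (meanWidth_le_of_injective (fun i => by simpa using hs1 (e i).2)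
      (Subtype.val_injective.comp e.injective))
  rintro _ ⟨i, rfl⟩
  exact ⟨e.symm ⟨v i, hs ⟨i, rfl⟩⟩, by simp⟩

end Width

section Gaussian

variable {Ω : Type*} [MeasurableSpace Ω] {μ : Measure Ω} {g : Fin 3 → Ω → ℝ}
  {ι : Type*} [Finite ι]

lemma integral_iSup_inner (hg : Measurable fun ω k => g k ω)
    (hlaw : Measure.map (fun ω k => g k ω) μ = Measure.pi fun _ => gaussianReal 0 1)
    (v : ι → EuclideanSpace ℝ (Fin 3)) :
    ∫ ω, (⨆ i, (√2)⁻¹ * inner ℝ (v i) (WithLp.toLp 2 fun k => g k ω)) ∂μ =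
      (√2)⁻¹ * meanWidth v := by
  have hmeas : Measurable fun ω =>
      (WithLp.toLp 2 fun k => g k ω : EuclideanSpace ℝ (Fin 3)) :=
    (by fun_prop : Measurable (WithLp.toLp 2 : (Fin 3 → ℝ) → EuclideanSpace ℝ (Fin 3))).comp hg
  have hmap : μ.map (fun ω => WithLp.toLp 2 fun k => g k ω) =
      stdGaussian (EuclideanSpace ℝ (Fin 3)) := by
    rw [← map_pi_eq_stdGaussian, ← hlaw, Measure.map_map (by fun_prop) hg]
    rfl
  rw [meanWidth, ← hmap, integral_map hmeas.aemeasurable, ← integral_const_mul]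
  · simp_rw [Real.mul_iSup_of_nonneg (inv_nonneg.2 (Real.sqrt_nonneg 2))]
  · exact (Measurable.iSup fun i => by fun_prop).aestronglyMeasurable

lemma integral_iInf_inner (hg : Measurable fun ω k => g k ω)
    (hlaw : Measure.map (fun ω k => g k ω) μ = Measure.pi fun _ => gaussianReal 0 1)
    (v : ι → EuclideanSpace ℝ (Fin 3)) :
    ∫ ω, (⨅ i, (√2)⁻¹ * inner ℝ (v i) (WithLp.toLp 2 fun k => g k ω)) ∂μ =
      -((√2)⁻¹ * meanWidth (-v)) := by
  rw [← integral_iSup_inner hg hlaw, ← integral_neg]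
  congr! 2 with ω
  simp only [Pi.neg_apply, inner_neg_left, mul_neg]
  rw [neg_eq_neg_one_mul, Real.mul_iSup_of_nonpos (by norm_num)]
  simp

end Gaussian

/-- **unrestricted qubit case.** For `d = 2`, the complete qubit MUB
ensemble (six states forming three mutually unbiased bases) is globally optimal among
arbitrary six-state ensembles: its expected random-Hamiltonian maximum dominates, and
its expected minimum is smallest. -/
theorem qubit_mub_globally_optimal
    (ψ : Fin 6 → Fin 2 → ℂ) (hψ : ∀ i, star (ψ i) ⬝ᵥ ψ i = (1 : ℂ))
    (B : Fin (2 + 1) → Fin 2 → Fin 2 → ℂ) (hB : IsCompleteMUB B)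
    {Ω : Type*} [MeasurableSpace Ω] (μ : Measure Ω) [IsProbabilityMeasure μ]
    (H : Ω → Matrix (Fin 2) (Fin 2) ℂ) (hH : IsStdGaussianHamiltonian μ H) :
    ((∫ ω, (⨆ i, ((H ω * Qmat (ψ i)).trace).re) ∂μ) ≤
        ∫ ω, (⨆ p : Fin (2 + 1) × Fin 2, ((H ω * Qmat (B p.1 p.2)).trace).re) ∂μ) ∧
      (∫ ω, (⨅ p : Fin (2 + 1) × Fin 2, ((H ω * Qmat (B p.1 p.2)).trace).re) ∂μ) ≤
        ∫ ω, (⨅ i, ((H ω * Qmat (ψ i)).trace).re) ∂μ := by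
  obtain ⟨E, g, hE, hE0, hort, hg, hlaw, hH⟩ := hH
  have htr : ∀ ω φ, ((H ω * Qmat φ).trace).re =
      (√2)⁻¹ * inner ℝ (blochVector E φ) (WithLp.toLp 2 fun k => g k ω) := fun ω φ => by
    rw [hH]; exact re_trace_mul_Qmat (fun k => g k ω) φ
  have hv : ∀ i, ‖blochVector E (ψ i)‖ = 1 := fun i => norm_blochVector hE hE0 hort (hψ i)
  have hoct := isOctahedron_blochVector hE hE0 hort hB
  have hc : 0 ≤ (√2)⁻¹ := by positivity
  simp only [htr]
  constructor
  · refine (integral_iSup_inner hg hlaw _).trans_le (le_trans ?_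
      (integral_iSup_inner hg hlaw _).ge)
    exact mul_le_mul_of_nonneg_left ((meanWidth_le hv).trans hoct.octahedronWidth_le) hc
  · refine (integral_iInf_inner hg hlaw _).trans_le (le_trans ?_
      (integral_iInf_inner hg hlaw _).ge)
    refine neg_le_neg (mul_le_mul_of_nonneg_left ?_ hc)
    exact (meanWidth_le fun i => by simpa using hv i).trans hoct.neg.octahedronWidth_le
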